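/- arXiv:2006.11369 — 4 statements merged into one kernel-verified Lean document; each statement's English description precedes it below -/
import Mathlib

section
/- Let n ≥ 1, let 0 ≤ s ≤ n be an integer, set p = s/n, and let (x_1,…,x_n) be uniformly distributed over the 0/1 vectors with Σ_{j=1}^n x_j = s. Let a_1,…,a_n ∈ ℝ and t ∈ ℝ satisfy |(a_j − a_k)t| ≤ π for all 1 ≤ j,k ≤ n. Then |E[exp(it·Σ_{j=1}^n a_j x_j)]| ≤ (n+1)·exp(−2p(1−p)·t²·V·n/π²), where V = (1/n)Σ_{j=1}^n a_j² − ((1/n)Σ_{j=1}^n a_j)² is the variance of a uniformly random coefficient a_J. -/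
open MeasureTheory
open scoped ENNReal NNReal

noncomputable section

/-- The uniform probability measure on a subset of a finite type. -/
def finUniform {γ : Type*} [Fintype γ] [MeasurableSpace γ] (s : Set γ) : Measure γ :=
  (Nat.card s : ℝ≥0∞)⁻¹ • ∑ a : γ, s.indicator (fun _ => (1 : ℝ≥0∞)) a • Measure.dirac a

end

lemma scf_coeff (n : ℕ) (c : ℕ → ℂ) (M : ℝ)
    (h : ∀ z : ℂ, ‖z‖ = 1 → ‖∑ k ∈ Finset.range (n + 1), c k * z ^ k‖ ≤ M) (s : ℕ) (hs : s ≤ n) :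
    ‖c s‖ ≤ M := by
  have hω := Complex.isPrimitiveRoot_exp (n + 1) (Nat.succ_ne_zero n)
  set ω := Complex.exp (2 * Real.pi * Complex.I / ((n + 1 : ℕ) : ℂ)) with hωdef
  have hω1 : ‖ω‖ = 1 := hω.norm'_eq_one (Nat.succ_ne_zero n)
  have hω0 : ω ≠ 0 := by
    intro h0
    rw [h0] at hω1
    simp at hω1
  have key : ∑ m ∈ Finset.range (n + 1),
      (∑ k ∈ Finset.range (n + 1), c k * (ω ^ m) ^ k) * ((ω ^ m) ^ s)⁻¹ = (n + 1) * c s := by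
    have : ∀ m ∈ Finset.range (n + 1),
        (∑ k ∈ Finset.range (n + 1), c k * (ω ^ m) ^ k) * ((ω ^ m) ^ s)⁻¹
        = ∑ k ∈ Finset.range (n + 1), c k * (ω ^ k * (ω ^ s)⁻¹) ^ m := by
      intro m _
      rw [Finset.sum_mul]
      refine Finset.sum_congr rfl fun k _ => ?_
      rw [mul_pow, inv_pow, ← pow_mul, ← pow_mul, ← pow_mul, ← pow_mul, mul_comm m k, mul_comm m s]
      ring
    rw [Finset.sum_congr rfl this, Finset.sum_comm]
    rw [Finset.sum_eq_single s]
    · rw [mul_inv_cancel₀ (pow_ne_zero _ hω0)]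
      simp
    · intro k hk hks
      rw [← Finset.mul_sum]
      have hr : ω ^ k * (ω ^ s)⁻¹ ≠ 1 := by
        intro h1
        have h2 : ω ^ k = ω ^ s := by
          field_simp at h1
          exact h1
        exact hks (hω.pow_inj (Finset.mem_range.mp hk) (by omega) h2)
      have hrN : (ω ^ k * (ω ^ s)⁻¹) ^ (n + 1) = 1 := by
        rw [mul_pow, inv_pow, ← pow_mul, ← pow_mul, mul_comm k, mul_comm s, pow_mul, pow_mul,
          hω.pow_eq_one]
        simp
      have hg := mul_geom_sum (ω ^ k * (ω ^ s)⁻¹) (n + 1)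
      rw [hrN, sub_self] at hg
      rcases mul_eq_zero.mp hg with h3 | h3
      · exact absurd (sub_eq_zero.mp h3) hr
      · rw [h3, mul_zero]
    · intro h'
      simp at h'
      omega
  have hb : ‖((n : ℂ) + 1) * c s‖ ≤ ((n : ℝ) + 1) * M := by
    rw [← key]
    refine (norm_sum_le _ _).trans ?_
    have : ∀ m ∈ Finset.range (n + 1),
      ‖(∑ k ∈ Finset.range (n + 1), c k * (ω ^ m) ^ k) * ((ω ^ m) ^ s)⁻¹‖ ≤ M := by
      intro m _
      rw [norm_mul, norm_inv, norm_pow, norm_pow, hω1]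
      simpa using h (ω ^ m) (by rw [norm_pow, hω1, one_pow])
    refine (Finset.sum_le_sum this).trans ?_
    simp
  have hn : ‖((n : ℂ) + 1)‖ = (n : ℝ) + 1 := by
    have := Complex.norm_natCast (n + 1)
    push_cast at this
    exact this
  rw [norm_mul, hn] at hb
  exact le_of_mul_le_mul_left hb (by positivity)

lemma scf_expand (n : ℕ) (p q : ℂ) (w : Fin n → ℂ) (z : ℂ) :
    ∏ j, (q + p * (z * w j)) = ∑ k ∈ Finset.range (n + 1),
      (p ^ k * q ^ (n - k) * ∑ T ∈ Finset.powersetCard k Finset.univ, ∏ j ∈ T, w j) * z ^ k := by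
  have h0 : ∏ j, (q + p * (z * w j)) = ∏ j, (p * (z * w j) + q) :=
    Finset.prod_congr rfl fun j _ => add_comm _ _
  rw [h0, Finset.prod_add, Finset.sum_powerset]
  simp only [Finset.card_univ, Fintype.card_fin]
  refine Finset.sum_congr rfl fun k _ => ?_
  rw [Finset.mul_sum, Finset.sum_mul]
  refine Finset.sum_congr rfl fun T hT => ?_
  have hc := (Finset.mem_powersetCard.mp hT).2
  have hc' : (Finset.univ \ T).card = n - k := by
    rw [← Finset.compl_eq_univ_sdiff, Finset.card_compl, hc, Fintype.card_fin]
  rw [Finset.prod_mul_distrib, Finset.prod_mul_distrib, Finset.prod_const, Finset.prod_const,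
    Finset.prod_const, hc, hc']
  ring

lemma scf_factor (p q : ℝ) (hpq : p + q = 1) (z : ℂ) (hz : ‖z‖ = 1) :
    ‖(q : ℂ) + p * z‖ ≤ Real.exp (-(p * q * (1 - z.re))) := by
  have h1 : z.re ^ 2 + z.im ^ 2 = 1 := by
    have := Complex.sq_norm z
    rw [hz, Complex.normSq_apply] at this
    linarith
  have h2 : ‖(q : ℂ) + p * z‖ ^ 2 = 1 - 2 * (p * q * (1 - z.re)) := by
    rw [Complex.sq_norm, Complex.normSq_apply]
    simp
    obtain rfl : q = 1 - p := by linarith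
    linear_combination p ^ 2 * h1
  refine abs_le_of_sq_le_sq' ?_ (Real.exp_pos _).le |>.2
  rw [h2, ← Real.exp_nat_mul]
  have := Real.add_one_le_exp (((2 : ℕ) : ℝ) * -(p * q * (1 - z.re)))
  refine le_trans (le_of_eq ?_) this
  push_cast
  ring

lemma scf_sum (n : ℕ) (hn : 1 ≤ n) (a : Fin n → ℝ) (t : ℝ)
    (hta : ∀ j k : Fin n, |(a j - a k) * t| ≤ Real.pi) :
    ‖∑ j, Complex.exp (Complex.I * ((t * a j : ℝ) : ℂ))‖ ≤
      n * (1 - 2 * t ^ 2 * ((∑ j, a j ^ 2) / n - ((∑ j, a j) / n) ^ 2) / Real.pi ^ 2) := by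
  have hn0 : (0 : ℝ) < n := by exact_mod_cast hn
  set V := (∑ j, a j ^ 2) / n - ((∑ j, a j) / n) ^ 2 with hV
  have hre : ∀ j, (Complex.exp (Complex.I * ((t * a j : ℝ) : ℂ))).re = Real.cos (t * a j) := by
    intro j
    rw [mul_comm, Complex.exp_ofReal_mul_I_re]
  have him : ∀ j, (Complex.exp (Complex.I * ((t * a j : ℝ) : ℂ))).im = Real.sin (t * a j) := by
    intro j
    rw [mul_comm, Complex.exp_ofReal_mul_I_im]
  have hsq : ‖∑ j, Complex.exp (Complex.I * ((t * a j : ℝ) : ℂ))‖ ^ 2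
      = ∑ j, ∑ k, Real.cos ((a j - a k) * t) := by
    rw [Complex.sq_norm, Complex.normSq_apply, Complex.re_sum, Complex.im_sum]
    simp only [hre, him]
    rw [Finset.sum_mul_sum, Finset.sum_mul_sum, ← Finset.sum_add_distrib]
    refine Finset.sum_congr rfl fun j _ => ?_
    rw [← Finset.sum_add_distrib]
    refine Finset.sum_congr rfl fun k _ => ?_
    rw [← Real.cos_sub]
    congr 1
    ring
  have hdd : ∑ j, ∑ k, (a j - a k) ^ 2 = 2 * n ^ 2 * V := by
    have : ∀ j k, (a j - a k) ^ 2 = a j ^ 2 + a k ^ 2 - 2 * (a j * a k) := fun j k => by ring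
    simp only [this, Finset.sum_sub_distrib, Finset.sum_add_distrib, ← Finset.mul_sum,
      ← Finset.sum_mul, Finset.sum_const, Finset.card_univ, Fintype.card_fin, nsmul_eq_mul]
    rw [hV]
    field_simp
    ring
  have hle : ∑ j, ∑ k, Real.cos ((a j - a k) * t)
      ≤ ∑ j, ∑ k, (1 - 2 / Real.pi ^ 2 * t ^ 2 * (a j - a k) ^ 2) := by
    refine Finset.sum_le_sum fun j _ => Finset.sum_le_sum fun k _ => ?_
    have := Real.cos_le_one_sub_mul_cos_sq (hta j k)
    refine this.trans (le_of_eq ?_)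
    ring
  have heq : ∑ j, ∑ k, (1 - 2 / Real.pi ^ 2 * t ^ 2 * (a j - a k) ^ 2)
      = n ^ 2 * (1 - 2 * (2 * t ^ 2 * V / Real.pi ^ 2)) := by
    simp only [Finset.sum_sub_distrib, ← Finset.mul_sum, hdd]
    simp
    ring
  set u := 2 * t ^ 2 * V / Real.pi ^ 2 with hu
  rw [← hsq, heq] at hle
  have h0 : 0 ≤ 1 - 2 * u := by
    have := (sq_nonneg _).trans hle
    exact nonneg_of_mul_nonneg_right this (by positivity)
  refine abs_le_of_sq_le_sq' ?_ (mul_nonneg hn0.le (by linarith)) |>.2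
  refine hle.trans ?_
  rw [mul_pow]
  exact mul_le_mul_of_nonneg_left (by nlinarith [sq_nonneg u]) (by positivity)

lemma scf_mode (n s : ℕ) (hs0 : 0 < s) (hsn : s < n) :
    1 ≤ ((n : ℝ) + 1) * ((n.choose s : ℝ) * ((s : ℝ) / n) ^ s * (1 - (s : ℝ) / n) ^ (n - s)) := by
  have hn0 : (0 : ℝ) < n := by exact_mod_cast hs0.trans hsn
  set p : ℝ := (s : ℝ) / n with hp
  have hp0 : 0 < p := by positivity
  have hq0 : 0 < 1 - p := by
    rw [hp, sub_pos, div_lt_one hn0]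
    exact_mod_cast hsn
  set b : ℕ → ℝ := fun k => (n.choose k : ℝ) * p ^ k * (1 - p) ^ (n - k) with hb
  have hb0 : ∀ k, 0 ≤ b k := fun k => by positivity
  have hpn : p * n = s := by rw [hp]; field_simp
  have hrec : ∀ k, k < n → b (k + 1) * ((k + 1) * (1 - p)) = b k * ((n - k) * p) := by
    intro k hk
    have h1 : (n.choose (k + 1) : ℝ) * (k + 1) = n.choose k * (n - k) := by
      have := Nat.choose_succ_right_eq n k
      have h2 : ((n.choose (k + 1) * (k + 1) : ℕ) : ℝ) = ((n.choose k * (n - k) : ℕ) : ℝ) := by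
        rw [this]
      push_cast [Nat.cast_sub hk.le] at h2
      exact h2
    obtain ⟨d, rfl⟩ : ∃ d, n = k + 1 + d := ⟨n - (k + 1), by omega⟩
    simp only [hb]
    rw [show k + 1 + d - (k + 1) = d by omega, show k + 1 + d - k = d + 1 by omega]
    linear_combination (p ^ (k + 1) * (1 - p) ^ (d + 1)) * h1
  have hup : ∀ k, k < s → b k ≤ b (k + 1) := by
    intro k hk
    have hks : (k : ℝ) + 1 ≤ s := by exact_mod_cast hk
    have hr := hrec k (by omega)
    have hpos : 0 < ((k : ℝ) + 1) * (1 - p) := by positivity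
    have hc : ((k : ℝ) + 1) * (1 - p) ≤ (n - k) * p := by nlinarith
    refine le_of_mul_le_mul_right ?_ hpos
    rw [hr]
    exact mul_le_mul_of_nonneg_left hc (hb0 k)
  have hdown : ∀ k, s ≤ k → k < n → b (k + 1) ≤ b k := by
    intro k hk hkn
    have hks : (s : ℝ) ≤ k := by exact_mod_cast hk
    have hr := hrec k hkn
    have hpos : 0 < ((k : ℝ) + 1) * (1 - p) := by positivity
    have hc : (n - k) * p ≤ ((k : ℝ) + 1) * (1 - p) := by nlinarith
    refine le_of_mul_le_mul_right ?_ hpos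
    rw [hr]
    exact mul_le_mul_of_nonneg_left hc (hb0 k)
  have hA : ∀ d, d ≤ s → b (s - d) ≤ b s := by
    intro d
    induction d with
    | zero => intro _; simp
    | succ d ih =>
      intro hd
      have := hup (s - (d + 1)) (by omega)
      rw [show s - (d + 1) + 1 = s - d by omega] at this
      exact this.trans (ih (by omega))
  have hB : ∀ d, s + d ≤ n → b (s + d) ≤ b s := by
    intro d
    induction d with
    | zero => intro _; simp
    | succ d ih =>
      intro hd
      exact (hdown (s + d) (by omega) (by omega)).trans (ih (by omega))
  have hall : ∀ k ∈ Finset.range (n + 1), b k ≤ b s := by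
    intro k hk
    have hk' := Finset.mem_range.mp hk
    rcases le_total k s with h | h
    · have := hA (s - k) (by omega)
      rwa [show s - (s - k) = k by omega] at this
    · have := hB (k - s) (by omega)
      rwa [show s + (k - s) = k by omega] at this
  have hsum : ∑ k ∈ Finset.range (n + 1), b k = 1 := by
    have := add_pow p (1 - p) n
    rw [show p + (1 - p) = 1 by ring, one_pow] at this
    rw [this]
    refine Finset.sum_congr rfl fun k _ => ?_
    simp only [hb]
    ring
  have := Finset.sum_le_sum hall
  rw [hsum] at this
  simpa using this

lemma scf_integral {γ : Type*} [Fintype γ] [MeasurableSpace γ] [MeasurableSingletonClass γ]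
    (P : γ → Prop) [DecidablePred P] (f : γ → ℂ) :
    ∫ x, f x ∂(finUniform {x | P x}) =
      ((Finset.univ.filter P).card : ℂ)⁻¹ * ∑ x ∈ Finset.univ.filter P, f x := by
  unfold finUniform
  have hc : Nat.card {x | P x} = (Finset.univ.filter P).card := by
    rw [Nat.card_eq_fintype_card]
    simp [Fintype.card_subtype]
  rw [integral_smul_measure, integral_finset_sum_measure]
  · rw [hc, Finset.sum_filter]
    simp only [integral_smul_measure, integral_dirac, ENNReal.toReal_inv, ENNReal.toReal_natCast]
    rw [Complex.real_smul]
    push_cast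
    congr 1
    refine Finset.sum_congr rfl fun x _ => ?_
    by_cases hx : P x <;> simp [hx]
  · intro x _
    by_cases hx : P x
    · simpa [hx] using integrable_dirac (by simp)
    · simp [hx]

lemma scf_reindex (n s : ℕ) (w : Fin n → ℂ) :
    ∑ x ∈ Finset.univ.filter (fun x : Fin n → Bool =>
        (Finset.univ.filter fun j => x j = true).card = s),
      ∏ j ∈ Finset.univ.filter (fun j => x j = true), w j
    = ∑ T ∈ Finset.powersetCard s Finset.univ, ∏ j ∈ T, w j := by
  refine Finset.sum_bij' (fun x _ => Finset.univ.filter fun j => x j = true)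
    (fun T _ => fun j => decide (j ∈ T)) ?_ ?_ ?_ ?_ ?_
  · intro x hx
    simpa [Finset.mem_powersetCard] using hx
  · intro T hT
    simpa [Finset.mem_powersetCard] using hT
  · intro x _
    ext j
    simp
  · intro T _
    ext j
    simp
  · intro x _
    rfl

lemma scf_card (n s : ℕ) :
    (Finset.univ.filter (fun x : Fin n → Bool =>
        (Finset.univ.filter fun j => x j = true).card = s)).card = n.choose s := by
  have h := scf_reindex n s (fun _ => 1)
  simp only [Finset.prod_const_one, Finset.sum_const, Finset.card_powersetCard, Finset.card_univ,
    Fintype.card_fin, nsmul_eq_mul, mul_one] at h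
  exact_mod_cast h

theorem slice_char_fun_bound
    (n : ℕ) (hn : 1 ≤ n) (s : ℕ) (hs : s ≤ n) (a : Fin n → ℝ) (t : ℝ)
    (hta : ∀ j k : Fin n, |(a j - a k) * t| ≤ Real.pi) :
    let p : ℝ := (s : ℝ) / n
    let μ := finUniform {x : Fin n → Bool | (Finset.univ.filter fun j => x j = true).card = s}
    let V : ℝ := (∑ j, a j ^ 2) / n - ((∑ j, a j) / n) ^ 2
    ‖∫ x, Complex.exp
        (Complex.I * Complex.ofReal (t * ∑ j, a j * (if x j then 1 else 0))) ∂μ‖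
      ≤ ((n : ℝ) + 1) * Real.exp (-2 * p * (1 - p) * t ^ 2 * V * n / Real.pi ^ 2) := by
  intro p μ V
  have hn0 : (0 : ℝ) < n := by exact_mod_cast hn
  set w : Fin n → ℂ := fun j => Complex.exp (Complex.I * ((t * a j : ℝ) : ℂ)) with hw
  have hw1 : ∀ j, ‖w j‖ = 1 := by
    intro j
    simp only [hw]
    rw [mul_comm, Complex.norm_exp_ofReal_mul_I]
  have hf : ∀ x : Fin n → Bool, Complex.exp
        (Complex.I * Complex.ofReal (t * ∑ j, a j * (if x j then 1 else 0)))
        = ∏ j ∈ Finset.univ.filter (fun j => x j = true), w j := by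
    intro x
    simp only [hw]
    rw [← Complex.exp_sum, ← Finset.mul_sum, ← Complex.ofReal_sum, ← Finset.mul_sum,
      Finset.sum_filter]
    simp
  have hint : ∫ x, Complex.exp
        (Complex.I * Complex.ofReal (t * ∑ j, a j * (if x j then 1 else 0))) ∂μ
      = (n.choose s : ℂ)⁻¹ * ∑ T ∈ Finset.powersetCard s Finset.univ, ∏ j ∈ T, w j := by
    rw [scf_integral, scf_card]
    simp only [hf]
    rw [scf_reindex]
  rw [hint, norm_mul, norm_inv, Complex.norm_natCast]
  set S := ∑ T ∈ Finset.powersetCard s Finset.univ, ∏ j ∈ T, w j with hS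
  have hCpos : (0 : ℝ) < n.choose s := by exact_mod_cast Nat.choose_pos hs
  by_cases hedge : 0 < s ∧ s < n
  · obtain ⟨hs0, hsn⟩ := hedge
    have hp0 : 0 < p := by
      have : (0 : ℝ) < s := by exact_mod_cast hs0
      exact div_pos this hn0
    have hq0 : 0 < 1 - p := by
      rw [sub_pos, div_lt_one hn0]
      exact_mod_cast hsn
    have hmode : 1 ≤ ((n : ℝ) + 1) * ((n.choose s : ℝ) * p ^ s * (1 - p) ^ (n - s)) :=
      scf_mode n s hs0 hsn
    set E := Real.exp (-2 * p * (1 - p) * t ^ 2 * V * n / Real.pi ^ 2) with hE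
    have hF : ∀ z : ℂ, ‖z‖ = 1 → ‖∑ k ∈ Finset.range (n + 1),
      (((p : ℝ) : ℂ) ^ k * (((1 - p : ℝ)) : ℂ) ^ (n - k) *
        ∑ T ∈ Finset.powersetCard k Finset.univ, ∏ j ∈ T, w j) * z ^ k‖ ≤ E := by
      intro z hz
      rw [← scf_expand, norm_prod]
      have h1 : ∀ j ∈ Finset.univ, ‖(((1 - p : ℝ)) : ℂ) + ((p : ℝ) : ℂ) * (z * w j)‖
          ≤ Real.exp (-(p * (1 - p) * (1 - (z * w j).re))) := fun j _ =>
        scf_factor p (1 - p) (by ring) _ (by rw [norm_mul, hz, hw1, one_mul])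
      refine (Finset.prod_le_prod (fun _ _ => norm_nonneg _) h1).trans ?_
      rw [← Real.exp_sum, hE]
      refine Real.exp_le_exp.mpr ?_
      have h2 : ∑ j, -(p * (1 - p) * (1 - (z * w j).re))
          = -(p * (1 - p) * (n - (z * ∑ j, w j).re)) := by
        rw [Finset.sum_neg_distrib, ← Finset.mul_sum, Finset.sum_sub_distrib, Finset.mul_sum,
          Complex.re_sum]
        simp
      have h3 : (z * ∑ j, w j).re ≤ n * (1 - 2 * t ^ 2 * V / Real.pi ^ 2) := by
        refine (Complex.re_le_norm _).trans ?_
        rw [norm_mul, hz, one_mul]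
        exact scf_sum n hn a t hta
      rw [h2]
      have h4 := mul_le_mul_of_nonneg_left h3 (mul_pos hp0 hq0).le
      have h5 : -2 * p * (1 - p) * t ^ 2 * V * n / Real.pi ^ 2
        = p * (1 - p) * (n * (1 - 2 * t ^ 2 * V / Real.pi ^ 2)) - p * (1 - p) * n := by ring
      rw [h5]
      linarith
    have hc := scf_coeff n _ E hF s hs
    rw [← hS, norm_mul, norm_mul, norm_pow, norm_pow, Complex.norm_real, Complex.norm_real,
      Real.norm_of_nonneg hp0.le, Real.norm_of_nonneg hq0.le] at hc
    have hSn : 0 ≤ ((n.choose s : ℝ))⁻¹ * ‖S‖ := by positivity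
    calc ((n.choose s : ℝ))⁻¹ * ‖S‖
        ≤ (((n : ℝ) + 1) * ((n.choose s : ℝ) * p ^ s * (1 - p) ^ (n - s))) *
          (((n.choose s : ℝ))⁻¹ * ‖S‖) := le_mul_of_one_le_left hSn hmode
      _ = ((n : ℝ) + 1) * (p ^ s * (1 - p) ^ (n - s) * ‖S‖) := by field_simp
      _ ≤ ((n : ℝ) + 1) * E := mul_le_mul_of_nonneg_left hc (by positivity)
  · have hpq : p * (1 - p) = 0 := by
      rcases (by omega : s = 0 ∨ s = n) with h | h
      · simp [p, h]
      · simp [p, h, hn0.ne']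
    have h5 : -2 * p * (1 - p) * t ^ 2 * V * n / Real.pi ^ 2 = 0 := by
      linear_combination (-2 * t ^ 2 * V * n / Real.pi ^ 2) * hpq
    rw [h5, Real.exp_zero, mul_one]
    have hSle : ‖S‖ ≤ n.choose s := by
      refine (norm_sum_le _ _).trans ?_
      simp [norm_prod, hw1]
    have : ((n.choose s : ℝ))⁻¹ * ‖S‖ ≤ 1 := by
      rw [inv_mul_le_iff₀ hCpos, mul_one]
      exact hSle
    linarith
end

section
/- Let k ≥ 0 and let X, Y_1, …, Y_k be mutually independent random variables (taking values in arbitrary measurable spaces), let f be a measurable real-valued function of (X, Y_1, …, Y_k), and set φ(t) = E[exp(it·f(X,Y_1,…,Y_k))]. Let Y_1^0, Y_1^1, …, Y_k^0, Y_k^1 be mutually independent and independent of X, with Y_j^b distributed as Y_j for each j and b ∈ {0,1}. Then for every t ∈ ℝ, |φ(t)|^{2^k} ≤ E_{Y}[ |E_X[exp(it·α(f)(X, Y_1^0, Y_1^1, …, Y_k^0, Y_k^1))]| ], where the inner expectation is over X only and the outer expectation is over the Y_j^b. -/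
open MeasureTheory ProbabilityTheory

universe u v

noncomputable section

/-- The decoupled version `α(f)` of a function of `(X, Y₁, …, Y_k)`:
`α(f)(X, Y^{0,1}) = Σ_{v ∈ {0,1}^k} (−1)^{|v|} f(X, Y^v)`. -/
def decouple {k : ℕ} {α : Type*} {β : Fin k → Type*}
    (f : α → (∀ j, β j) → ℝ) (x : α) (y : ∀ j, β j × β j) : ℝ :=
  ∑ v : Fin k → Bool,
    (-1 : ℝ) ^ (Finset.univ.filter fun j => v j = true).card *
      f x (fun j => if v j then (y j).2 else (y j).1)

/-- The target type family for the joint family `(X, (Y_j^b)_{j,b})`. -/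
def decoupleTarget {k : ℕ} (α : Type u) (β : Fin k → Type u) :
    Option (Fin k × Bool) → Type u
  | none => α
  | some jb => β jb.1

/-- The measurable-space structures on the targets. -/
def decoupleTargetMS {k : ℕ} {α : Type u} {β : Fin k → Type u}
    [mα : MeasurableSpace α] [mβ : ∀ j, MeasurableSpace (β j)] :
    ∀ o : Option (Fin k × Bool), MeasurableSpace (decoupleTarget α β o)
  | none => mα
  | some jb => mβ jb.1

/-- The joint family `(X, (Y_j^b)_{j,b})` as a single indexed family of random variables. -/
def decoupleFam {k : ℕ} {Ω : Type v} {α : Type u} {β : Fin k → Type u}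
    (X : Ω → α) (Y : ∀ j : Fin k, Bool → Ω → β j) :
    ∀ o : Option (Fin k × Bool), Ω → decoupleTarget α β o
  | none => X
  | some jb => Y jb.1 jb.2

end

lemma dc_basic
    {k : ℕ} {Ω : Type v} [MeasurableSpace Ω] (μ : Measure Ω) [IsProbabilityMeasure μ]
    {α : Type u} [MeasurableSpace α] {β : Fin k → Type u} [∀ j, MeasurableSpace (β j)]
    (X : Ω → α) (Y : ∀ j : Fin k, Bool → Ω → β j)
    (hindep : ProbabilityTheory.iIndepFun (m := fun o => decoupleTargetMS (α := α) (β := β) o)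
      (decoupleFam X Y) μ)
    (A : Set α) (hA : MeasurableSet A) (S : ∀ j, Bool → Set (β j))
    (hS : ∀ j b, MeasurableSet (S j b)) :
    μ (X ⁻¹' A ∩ ⋂ j, ((Y j false) ⁻¹' (S j false) ∩ (Y j true) ⁻¹' (S j true))) =
      μ (X ⁻¹' A) * ∏ j, (μ ((Y j false) ⁻¹' (S j false)) * μ ((Y j true) ⁻¹' (S j true))) := by
  let s : ∀ o : Option (Fin k × Bool), Set Ω := fun o => match o with
    | none => X ⁻¹' A
    | some jb => Y jb.1 jb.2 ⁻¹' S jb.1 jb.2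
  have h := iIndepFun.meas_iInter (s := s) hindep (by
    rintro (_ | ⟨j, b⟩)
    · exact ⟨A, hA, rfl⟩
    · exact ⟨S j b, hS j b, rfl⟩)
  rw [Fintype.prod_option, Fintype.prod_prod_type, Set.iInter_option] at h
  simp only [Fintype.prod_bool, s] at h
  convert h using 1
  · congr 2
    ext ω
    simp [Prod.forall, Bool.forall_bool]
  · simp only [mul_comm]

lemma dc_pairs
    {k : ℕ} {Ω : Type v} [MeasurableSpace Ω] (μ : Measure Ω) [IsProbabilityMeasure μ]
    {α : Type u} [MeasurableSpace α] {β : Fin k → Type u} [∀ j, MeasurableSpace (β j)]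
    (X : Ω → α) (Y : ∀ j : Fin k, Bool → Ω → β j)
    (hY : ∀ j b, Measurable (Y j b))
    (hindep : ProbabilityTheory.iIndepFun (m := fun o => decoupleTargetMS (α := α) (β := β) o)
      (decoupleFam X Y) μ) :
    Measure.pi (fun j => (μ.map (Y j false)).prod (μ.map (Y j true))) =
      μ.map (fun ω j => (Y j false ω, Y j true ω)) := by
  have hp : ∀ j b, IsProbabilityMeasure (μ.map (Y j b)) := fun j b =>
    Measure.isProbabilityMeasure_map (hY j b).aemeasurable
  have hm : Measurable (fun ω j => (Y j false ω, Y j true ω)) :=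
    measurable_pi_lambda _ fun j => (hY j false).prodMk (hY j true)
  refine Measure.pi_eq_generateFrom (fun _ => generateFrom_prod) (fun _ => isPiSystem_prod)
    (fun j => ?_) ?_
  · exact ⟨fun _ => Set.univ, fun _ => ⟨Set.univ, MeasurableSet.univ, Set.univ, MeasurableSet.univ,
      by simp⟩, fun _ => by simp, Set.iUnion_const _⟩
  · intro s hs
    choose A hA B hB hAB using hs
    have h := dc_basic μ X Y hindep Set.univ .univ
      (fun j b => if b then B j else A j) (fun j b => by cases b; exacts [hA j, hB j])
    rw [Measure.map_apply hm (MeasurableSet.univ_pi fun j => by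
      rw [← hAB]; exact (hA j).prod (hB j))]
    obtain rfl : (fun j => A j ×ˢ B j) = s := funext hAB
    simp only [Measure.prod_prod]
    simp only [Set.preimage_univ, Set.univ_inter, measure_univ, one_mul] at h
    simp only [Measure.map_apply (hY _ _) (hA _), Measure.map_apply (hY _ _) (hB _)]
    convert h using 1
    · congr 1
      ext ω
      simp
    · simp

lemma dc_single
    {k : ℕ} {Ω : Type v} [MeasurableSpace Ω] (μ : Measure Ω) [IsProbabilityMeasure μ]
    {α : Type u} [MeasurableSpace α] {β : Fin k → Type u} [∀ j, MeasurableSpace (β j)]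
    (X : Ω → α) (Y : ∀ j : Fin k, Bool → Ω → β j)
    (hX : Measurable X) (hY : ∀ j b, Measurable (Y j b))
    (hindep : ProbabilityTheory.iIndepFun (m := fun o => decoupleTargetMS (α := α) (β := β) o)
      (decoupleFam X Y) μ) :
    (μ.map X).prod (Measure.pi (fun j => μ.map (Y j false))) =
      μ.map (fun ω => (X ω, fun j => Y j false ω)) := by
  have hp : ∀ j b, IsProbabilityMeasure (μ.map (Y j b)) := fun j b =>
    Measure.isProbabilityMeasure_map (hY j b).aemeasurable
  have hpX : IsProbabilityMeasure (μ.map X) :=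
    Measure.isProbabilityMeasure_map hX.aemeasurable
  have hm : Measurable (fun ω j => Y j false ω) :=
    measurable_pi_lambda _ fun j => hY j false
  refine Measure.prod_eq_generateFrom MeasurableSpace.generateFrom_measurableSet generateFrom_pi
    MeasurableSpace.isPiSystem_measurableSet isPiSystem_pi
    (Measure.toFiniteSpanningSetsIn _) ?_ ?_
  · exact ⟨fun _ => Set.univ, fun _ => ⟨fun _ => Set.univ, by simp, by simp⟩,
      fun _ => by simp, Set.iUnion_const _⟩
  · rintro A hA _ ⟨s, hs, rfl⟩
    have hs : ∀ j, MeasurableSet (s j) := fun j => hs j (Set.mem_univ j)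
    have h := dc_basic μ X Y hindep A hA
      (fun j b => if b then Set.univ else s j)
      (fun j b => by cases b; exacts [hs j, MeasurableSet.univ])
    rw [Measure.map_apply (hX.prodMk hm) (hA.prod (MeasurableSet.univ_pi hs))]
    simp only [Measure.pi_pi, Measure.map_apply (hY _ _) (hs _), Measure.map_apply hX hA]
    simp only [if_true, Set.preimage_univ, Set.inter_univ, measure_univ, mul_one] at h
    convert h using 1
    · congr 1
      ext ω
      simp
    · simp

lemma dc_succ {k : ℕ} {α : Type*} {β : Fin (k + 1) → Type*}
    (f : α → (∀ j, β j) → ℝ) (x : α) (w : β 0 × β 0) (y : ∀ j : Fin k, β j.succ × β j.succ) :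
    decouple f x (Fin.cons w y : ∀ j, β j × β j) =
      decouple (fun x z => f x (Fin.cons w.1 z : ∀ j, β j) - f x (Fin.cons w.2 z : ∀ j, β j)) x y := by
  unfold decouple
  rw [← (Fin.consEquiv fun _ : Fin (k + 1) => Bool).sum_comp, Fintype.sum_prod_type]
  simp only [Fintype.sum_bool, Fin.consEquiv_apply]
  rw [add_comm, ← Finset.sum_add_distrib]
  refine Finset.sum_congr rfl fun v _ => ?_
  have h1 : ∀ b : Bool, (fun j => if (Fin.cons b v : Fin (k+1) → Bool) j then
      ((Fin.cons w y : ∀ j, β j × β j) j).2 else ((Fin.cons w y : ∀ j, β j × β j) j).1) =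
      (Fin.cons (if b then w.2 else w.1) (fun j => if v j then (y j).2 else (y j).1) : ∀ j, β j) := by
    intro b
    funext j
    refine Fin.cases ?_ (fun j => ?_) j <;> simp
  rw [h1, h1, Fin.card_filter_univ_succ, Fin.card_filter_univ_succ]
  simp [pow_succ]
  ring

lemma dc_pow_integral {γ : Type*} [MeasurableSpace γ] (m : Measure γ) [IsProbabilityMeasure m]
    (h : γ → ℂ) (hm : AEStronglyMeasurable h m) (hb : ∀ x, ‖h x‖ ≤ 1) (n : ℕ) :
    ‖∫ x, h x ∂m‖ ^ n ≤ ∫ x, ‖h x‖ ^ n ∂m := by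
  have h1 : Integrable (fun x => ‖h x‖) m :=
    (Integrable.of_bound hm 1 (Filter.Eventually.of_forall hb)).norm
  have h2 : Integrable (fun x => ‖h x‖ ^ n) m :=
    Integrable.of_bound (hm.norm.pow n) 1 (Filter.Eventually.of_forall fun x => by
      rw [norm_pow, norm_norm]; exact pow_le_one₀ (norm_nonneg _) (hb x))
  refine (pow_le_pow_left₀ (norm_nonneg _) (norm_integral_le_integral_norm h) n).trans ?_
  exact (convexOn_pow n).map_integral_le (by fun_prop) isClosed_Ici
    (Filter.Eventually.of_forall fun x => norm_nonneg _) h1 h2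

/-- the character -/
noncomputable def dcE (r : ℝ) : ℂ := Complex.exp (Complex.I * Complex.ofReal r)

lemma dcE_norm (r : ℝ) : ‖dcE r‖ = 1 := by
  unfold dcE; rw [mul_comm]; exact Complex.norm_exp_ofReal_mul_I r

lemma dcE_meas : Measurable dcE := by unfold dcE; fun_prop

lemma dcE_aesm {γ : Type*} [MeasurableSpace γ] (m : Measure γ)
    {h : γ → ℝ} (hh : Measurable h) : AEStronglyMeasurable (fun x => dcE (h x)) m :=
  (dcE_meas.comp hh).aestronglyMeasurable

lemma dcE_sub (r s : ℝ) : dcE (r - s) = dcE r * (starRingEnd ℂ) (dcE s) := by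
  unfold dcE
  rw [← Complex.exp_conj, ← Complex.exp_add]
  congr 1
  simp
  ring

lemma dcE_int {γ : Type*} [MeasurableSpace γ] (m : Measure γ) [IsProbabilityMeasure m]
    {h : γ → ℝ} (hh : Measurable h) : Integrable (fun x => dcE (h x)) m :=
  Integrable.of_bound (dcE_meas.comp hh).aestronglyMeasurable 1
    (Filter.Eventually.of_forall fun _ => (dcE_norm _).le)

lemma dcE_int_le {γ : Type*} [MeasurableSpace γ] (m : Measure γ) [IsProbabilityMeasure m]
    (h : γ → ℝ) : ‖∫ x, dcE (h x) ∂m‖ ≤ 1 := by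
  have := norm_integral_le_of_norm_le_const (μ := m) (f := fun x => dcE (h x)) (C := 1)
    (Filter.Eventually.of_forall fun _ => (dcE_norm _).le)
  simpa using this

lemma dcE_sq {γ : Type*} [MeasurableSpace γ] (m : Measure γ) [IsProbabilityMeasure m]
    (h : γ → ℝ) :
    ((‖∫ x, dcE (h x) ∂m‖ ^ 2 : ℝ) : ℂ) = ∫ w, dcE (h w.1 - h w.2) ∂(m.prod m) := by
  simp only [dcE_sub]
  rw [integral_prod_mul (fun x => dcE (h x)) (fun x => (starRingEnd ℂ) (dcE (h x))),
    integral_conj, Complex.mul_conj, Complex.normSq_eq_norm_sq]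

/-- one step -/
lemma dc_step {γ δ : Type*} [MeasurableSpace γ] [MeasurableSpace δ]
    (Q : Measure γ) [IsProbabilityMeasure Q] (m : Measure δ) [IsProbabilityMeasure m]
    (h : γ → δ → ℝ) (hh : Measurable fun q : γ × δ => h q.1 q.2) :
    ‖∫ q, ∫ y, dcE (h q y) ∂m ∂Q‖ ^ 2 ≤
      ∫ w, ‖∫ q, dcE (h q w.1 - h q w.2) ∂Q‖ ∂(m.prod m) := by
  have hm1 : StronglyMeasurable (fun q => ∫ y, dcE (h q y) ∂m) :=
    (dcE_meas.comp hh).stronglyMeasurable.integral_prod_right'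
  have hg : Measurable fun p : γ × (δ × δ) => h p.1 p.2.1 - h p.1 p.2.2 :=
    (hh.comp (measurable_fst.prodMk measurable_snd.fst)).sub
      (hh.comp (measurable_fst.prodMk measurable_snd.snd))
  have h1 := dc_pow_integral Q (fun q => ∫ y, dcE (h q y) ∂m) hm1.aestronglyMeasurable
    (fun q => dcE_int_le m _) 2
  refine h1.trans ?_
  have h2 : ((∫ q, ‖∫ y, dcE (h q y) ∂m‖ ^ 2 ∂Q : ℝ) : ℂ) =
      ∫ w, ∫ q, dcE (h q w.1 - h q w.2) ∂Q ∂(m.prod m) := by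
    rw [← integral_complex_ofReal]
    simp only [dcE_sq]
    exact integral_integral_swap (dcE_int (Q.prod (m.prod m)) hg)
  refine le_trans (le_of_eq ?_) (norm_integral_le_integral_norm _)
  rw [← h2, Complex.norm_real, Real.norm_of_nonneg]
  exact integral_nonneg fun q => by positivity

lemma dc_meas {k : ℕ} {α : Type*} [MeasurableSpace α] {β : Fin k → Type*}
    [∀ j, MeasurableSpace (β j)] {δ : Type*} [MeasurableSpace δ]
    (f : δ → α → (∀ j, β j) → ℝ)
    (hf : Measurable fun q : δ × (α × (∀ j, β j)) => f q.1 q.2.1 q.2.2) :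
    Measurable fun q : (δ × (∀ j, β j × β j)) × α => decouple (f q.1.1) q.2 q.1.2 := by
  unfold decouple
  refine Finset.measurable_sum _ fun v _ => Measurable.const_mul ?_ _
  refine hf.comp (measurable_fst.fst.prodMk (measurable_snd.prodMk
    (measurable_pi_lambda _ fun j => ?_)))
  change Measurable fun q : (δ × (∀ j, β j × β j)) × α =>
    if v j = true then (q.1.2 j).2 else (q.1.2 j).1
  have : Measurable fun q : (δ × (∀ j, β j × β j)) × α => q.1.2 j :=
    (measurable_pi_apply j).comp measurable_fst.snd
  by_cases hv : v j = true
  · simp only [hv, if_true]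
    exact this.snd
  · simp only [hv]
    exact this.fst

lemma dc_cons {k : ℕ} {β : Fin (k + 1) → Type*} [∀ j, MeasurableSpace (β j)]
    (ν : ∀ j, Measure (β j)) [∀ j, IsProbabilityMeasure (ν j)] :
    MeasurePreserving (fun p : β 0 × (∀ j : Fin k, β j.succ) => (Fin.cons p.1 p.2 : ∀ j, β j))
      ((ν 0).prod (Measure.pi fun j : Fin k => ν j.succ)) (Measure.pi ν) := by
  have hm : Measurable
      (fun p : β 0 × (∀ j : Fin k, β j.succ) => (Fin.cons p.1 p.2 : ∀ j, β j)) := by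
    refine measurable_pi_lambda _ fun j => ?_
    refine Fin.cases ?_ (fun j => ?_) j
    · simpa using measurable_fst
    · simp only [Fin.cons_succ]
      exact (measurable_pi_apply j).comp measurable_snd
  refine ⟨hm, (Measure.pi_eq fun s hs => ?_).symm⟩
  rw [Measure.map_apply hm (MeasurableSet.univ_pi hs), Fin.prod_univ_succ,
    ← Measure.pi_pi, ← Measure.prod_prod]
  congr 1
  ext p
  simp [Fin.forall_fin_succ]

lemma dc_core (k : ℕ) : ∀ {α : Type u} [MeasurableSpace α] {β : Fin k → Type u}
    [∀ j, MeasurableSpace (β j)] (P : Measure α) [IsProbabilityMeasure P]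
    (ν : ∀ j, Measure (β j)) [∀ j, IsProbabilityMeasure (ν j)]
    (f : α → (∀ j, β j) → ℝ) (_ : Measurable fun q : α × (∀ j, β j) => f q.1 q.2),
    ‖∫ q, dcE (f q.1 q.2) ∂(P.prod (Measure.pi ν))‖ ^ (2 ^ k) ≤
      ∫ y, ‖∫ x, dcE (decouple f x y) ∂P‖ ∂(Measure.pi fun j => (ν j).prod (ν j)) := by
  induction k with
  | zero =>
    intro α _ β _ P _ ν _ f hf
    have h1 : ∀ x y, decouple f x y = f x (fun j => j.elim0) := by
      intro x y
      simp [decouple]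
      congr 1
      funext j
      exact j.elim0
    have h2 : ∀ x y, f x y = f x (fun j => j.elim0) := by
      intro x y
      congr 1
      funext j
      exact j.elim0
    rw [integral_prod _ (dcE_int _ hf)]
    simp only [h1]
    simp only [fun x (y : ∀ j, β j) => h2 x y]
    simp
  | succ k ih =>
    intro α _ β _ P _ ν _ f hf
    let ν' : ∀ j : Fin k, Measure (β j.succ) := fun j => ν j.succ
    let c : β 0 × (∀ j : Fin k, β j.succ) → ∀ j, β j := fun p => Fin.cons p.1 p.2
    have hc : MeasurePreserving c ((ν 0).prod (Measure.pi ν')) (Measure.pi ν) :=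
      dc_cons ν
    let c2 : (β 0 × β 0) × (∀ j : Fin k, β j.succ × β j.succ) → ∀ j, β j × β j :=
      fun p => Fin.cons p.1 p.2
    have hc2 : MeasurePreserving c2 (((ν 0).prod (ν 0)).prod
        (Measure.pi fun j => (ν' j).prod (ν' j))) (Measure.pi fun j => (ν j).prod (ν j)) :=
      dc_cons (fun j => (ν j).prod (ν j))
    let Q := P.prod (Measure.pi ν')
    let h : (α × (∀ j : Fin k, β j.succ)) → β 0 → ℝ := fun q y => f q.1 (c (y, q.2))
    have hh : Measurable fun q : (α × (∀ j : Fin k, β j.succ)) × β 0 => h q.1 q.2 :=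
      hf.comp (measurable_fst.fst.prodMk (hc.measurable.comp
        (measurable_snd.prodMk measurable_fst.snd)))
    have e1 : ∫ q, dcE (f q.1 q.2) ∂(P.prod (Measure.pi ν)) =
        ∫ q, ∫ y, dcE (h q y) ∂(ν 0) ∂Q := by
      rw [integral_prod _ (dcE_int _ hf), integral_prod]
      · congr 1
        ext x
        have hfx : Measurable (f x) := hf.comp (measurable_const.prodMk measurable_id)
        rw [← hc.map_eq, integral_map hc.measurable.aemeasurable
          (dcE_aesm _ hfx),
          integral_prod_symm _ (dcE_int (h := fun p => f x (c p)) _ (hfx.comp hc.measurable))]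
      · exact (dcE_int (Q.prod (ν 0)) hh).integral_prod_left
    let g : β 0 × β 0 → α → (∀ j : Fin k, β j.succ) → ℝ := fun w x z =>
      f x (c (w.1, z)) - f x (c (w.2, z))
    have hg : Measurable fun q : (β 0 × β 0) × (α × (∀ j : Fin k, β j.succ)) =>
        g q.1 q.2.1 q.2.2 :=
      (hf.comp (measurable_snd.fst.prodMk (hc.measurable.comp
        (measurable_fst.fst.prodMk measurable_snd.snd)))).sub
      (hf.comp (measurable_snd.fst.prodMk (hc.measurable.comp
        (measurable_fst.snd.prodMk measurable_snd.snd))))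
    have hD : Measurable fun p : ((β 0 × β 0) × (∀ j : Fin k, β j.succ × β j.succ)) × α =>
      decouple (g p.1.1) p.2 p.1.2 := dc_meas g hg
    have hN : StronglyMeasurable
        fun p : (β 0 × β 0) × (∀ j : Fin k, β j.succ × β j.succ) =>
        ‖∫ x, dcE (decouple (g p.1) x p.2) ∂P‖ :=
      ((dcE_meas.comp hD).stronglyMeasurable.integral_prod_right' (ν := P)).norm
    have hNi : Integrable (fun p : (β 0 × β 0) × (∀ j : Fin k, β j.succ × β j.succ) =>
        ‖∫ x, dcE (decouple (g p.1) x p.2) ∂P‖) (((ν 0).prod (ν 0)).prod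
        (Measure.pi fun j => (ν' j).prod (ν' j))) :=
      Integrable.of_bound hN.aestronglyMeasurable 1 (Filter.Eventually.of_forall fun p => by
        rw [norm_norm]; exact dcE_int_le P _)
    have e2 : ∫ y, ‖∫ x, dcE (decouple f x y) ∂P‖ ∂(Measure.pi fun j => (ν j).prod (ν j)) =
        ∫ w, ∫ y, ‖∫ x, dcE (decouple (g w) x y) ∂P‖
          ∂(Measure.pi fun j => (ν' j).prod (ν' j)) ∂((ν 0).prod (ν 0)) := by
      have hfm : StronglyMeasurable fun y => ‖∫ x, dcE (decouple f x y) ∂P‖ := by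
        have := (dc_meas (δ := Unit) (fun _ => f) (hf.comp measurable_snd)).comp
          (((measurable_const (a := ())).prodMk (measurable_fst (α := ∀ j, β j × β j)
            (β := α))).prodMk measurable_snd)
        exact ((dcE_meas.comp this).stronglyMeasurable.integral_prod_right' (ν := P)).norm
      rw [← hc2.map_eq, integral_map hc2.measurable.aemeasurable hfm.aestronglyMeasurable,
        ← integral_prod _ hNi]
      congr 1
      ext p
      congr 2
      ext x
      rw [show c2 p = (Fin.cons p.1 p.2 : ∀ j, β j × β j) from rfl, dc_succ]
    rw [e1, e2, pow_succ', pow_mul]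
    have s1 := dc_step Q (ν 0) h hh
    have hI : StronglyMeasurable fun w : β 0 × β 0 => ∫ q, dcE (g w q.1 q.2) ∂Q :=
      (dcE_meas.comp hg).stronglyMeasurable.integral_prod_right' (ν := Q)
    calc _ ≤ (∫ w, ‖∫ q, dcE (g w q.1 q.2) ∂Q‖ ∂((ν 0).prod (ν 0))) ^ (2 ^ k) :=
          pow_le_pow_left₀ (by positivity) s1 _
      _ = ‖∫ w, ((‖∫ q, dcE (g w q.1 q.2) ∂Q‖ : ℝ) : ℂ) ∂((ν 0).prod (ν 0))‖ ^ (2 ^ k) := by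
          rw [integral_complex_ofReal, Complex.norm_real, Real.norm_of_nonneg]
          exact integral_nonneg fun w => norm_nonneg _
      _ ≤ ∫ w, ‖((‖∫ q, dcE (g w q.1 q.2) ∂Q‖ : ℝ) : ℂ)‖ ^ (2 ^ k) ∂((ν 0).prod (ν 0)) := by
          refine dc_pow_integral _ _ ?_ ?_ _
          · exact (Complex.measurable_ofReal.comp hI.norm.measurable).aestronglyMeasurable
          · intro w
            rw [Complex.norm_real, norm_norm]
            exact dcE_int_le Q _
      _ ≤ _ := by
          refine integral_mono_of_nonneg (Filter.Eventually.of_forall fun w => by positivity)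
            hNi.integral_prod_left (Filter.Eventually.of_forall fun w => ?_)
          simp only [Complex.norm_real, norm_norm]
          exact ih P ν' (g w) (hg.comp (measurable_const.prodMk measurable_id))

theorem decoupling_independent
    (k : ℕ) {Ω : Type v} [MeasurableSpace Ω] (μ : Measure Ω) [IsProbabilityMeasure μ]
    {α : Type u} [MeasurableSpace α] {β : Fin k → Type u} [∀ j, MeasurableSpace (β j)]
    (X : Ω → α) (Y : ∀ j : Fin k, Bool → Ω → β j)
    (hX : Measurable X) (hY : ∀ j b, Measurable (Y j b))
    (hindep : ProbabilityTheory.iIndepFun (m := fun o => decoupleTargetMS (α := α) (β := β) o)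
      (decoupleFam X Y) μ)
    (hid : ∀ j : Fin k, μ.map (Y j true) = μ.map (Y j false))
    (f : α → (∀ j, β j) → ℝ)
    (hf : Measurable fun q : α × (∀ j, β j) => f q.1 q.2) (t : ℝ) :
    ‖∫ ω, Complex.exp (Complex.I * Complex.ofReal
        (t * f (X ω) fun j => Y j false ω)) ∂μ‖ ^ (2 ^ k)
      ≤ ∫ ω, ‖∫ x, Complex.exp (Complex.I * Complex.ofReal
            (t * decouple f x fun j => (Y j false ω, Y j true ω))) ∂(μ.map X)‖ ∂μ := by
  have hp : ∀ j b, IsProbabilityMeasure (μ.map (Y j b)) := fun j b =>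
    Measure.isProbabilityMeasure_map (hY j b).aemeasurable
  have hpX : IsProbabilityMeasure (μ.map X) :=
    Measure.isProbabilityMeasure_map hX.aemeasurable
  have htf : Measurable fun q : α × (∀ j, β j) => t * f q.1 q.2 := hf.const_mul t
  have h := dc_core k (μ.map X) (fun j => μ.map (Y j false)) (fun x y => t * f x y) htf
  have hd : ∀ x y, decouple (fun x y => t * f x y) x y = t * decouple f x y := by
    intro x y
    unfold decouple
    rw [Finset.mul_sum]
    exact Finset.sum_congr rfl fun v _ => by ring
  have hpair := dc_pairs μ X Y hY hindep
  simp only [hid] at hpair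
  have hm : Measurable (fun ω j => Y j false ω) := measurable_pi_lambda _ fun j => hY j false
  have hm2 : Measurable (fun ω j => (Y j false ω, Y j true ω)) :=
    measurable_pi_lambda _ fun j => (hY j false).prodMk (hY j true)
  have hfm : StronglyMeasurable
      fun y => ‖∫ x, dcE (decouple (fun x y => t * f x y) x y) ∂(μ.map X)‖ := by
    have := (dc_meas (δ := Unit) (fun _ => fun x y => t * f x y) (htf.comp measurable_snd)).comp
      (((measurable_const (a := ())).prodMk (measurable_fst (α := ∀ j, β j × β j)
        (β := α))).prodMk measurable_snd)
    exact ((dcE_meas.comp this).stronglyMeasurable.integral_prod_right' (ν := μ.map X)).norm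
  rw [dc_single μ X Y hX hY hindep, hpair,
    integral_map (hX.prodMk hm).aemeasurable (dcE_aesm _ htf),
    integral_map hm2.aemeasurable hfm.aestronglyMeasurable] at h
  simp only [hd] at h
  exact h
end

section
/- Fix 0 ≤ S ≤ n and let (x_i)_{i∈{1,…,n}} be a uniformly random 0/1 vector with Σ_{i=1}^n x_i = S (equivalently, i.i.d. Bernoulli variables conditioned on their sum being S). Let A, B_1, …, B_k be sets partitioning {1,…,n}, and set X = (x_i)_{i∈A}, Y_j = (x_i)_{i∈B_j}, and Z_j = Σ_{i∈B_j} x_i for 1 ≤ j ≤ k. Let f be a measurable real-valued function and φ(t) = E[exp(it·f(X, Y_1, …, Y_k))]. Consider the joint law in which (Z_1,…,Z_k) is distributed as above and, conditionally on (Z_1,…,Z_k), the vectors X, Y_1^0, Y_1^1, …, Y_k^0, Y_k^1 are independent, X being uniform over 0/1 vectors on A with S − Σ_j Z_j ones and each Y_j^b uniform over 0/1 vectors on B_j with Z_j ones. Then for every t ∈ ℝ, |φ(t)|^{2^k} ≤ E_{Z_1,…,Z_k, Y_1^0, Y_1^1, …, Y_k^0, Y_k^1}[ |E_X[ exp(it·α(f)(X,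 Y_1^0, Y_1^1, …, Y_k^0, Y_k^1)) | Z_1, …, Z_k ]| ], where the inner conditional expectation averages over X only. -/
open MeasureTheory
open scoped ENNReal NNReal

noncomputable section

/-- Glue a vector defined on `A` with vectors defined on the blocks `B j` of a partition. -/
def glue {n k : ℕ} (A : Finset (Fin n)) (B : Fin k → Finset (Fin n))
    (xA : Fin n → Bool) (y : Fin k → Fin n → Bool) : Fin n → Bool :=
  fun i => if i ∈ A then xA i else Finset.univ.sup fun j => if i ∈ B j then y j i else false

/-- The decoupled version `α(f)` of `f` with respect to the partition `A, B₁, …, B_k`: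
`α(f)(X, Y^{0,1}) = Σ_{v ∈ {0,1}^k} (−1)^{|v|} f(X, Y^v)`. -/
def alphaSlice {n k : ℕ} (A : Finset (Fin n)) (B : Fin k → Finset (Fin n))
    (f : (Fin n → Bool) → ℝ) (xA : Fin n → Bool)
    (y : Fin k → Bool → Fin n → Bool) : ℝ :=
  ∑ v : Fin k → Bool,
    (-1 : ℝ) ^ (Finset.univ.filter fun j => v j = true).card *
      f (glue A B xA fun j => y j (v j))

end

open Finset in
open scoped BigOperators in
lemma aux_integral {γ E : Type*} [Fintype γ] [MeasurableSpace γ] [MeasurableSingletonClass γ]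
    [NormedAddCommGroup E] [NormedSpace ℝ E] [CompleteSpace E] [Module ℚ≥0 E]
    (s : Finset γ) (S : Set γ) (hs : ∀ x, x ∈ S ↔ x ∈ s) (g : γ → E) :
    ∫ x, g x ∂(finUniform S) = 𝔼 x ∈ s, g x := by
  classical
  obtain rfl : S = ↑s := by ext x; simp [hs]
  unfold finUniform
  rw [integral_smul_measure, integral_finsetSum_measure]
  · simp only [integral_smul_measure, integral_dirac]
    rw [Finset.expect, ← NNRat.cast_smul_eq_nnqsmul ℝ]
    simp [Set.indicator_apply, apply_ite ENNReal.toReal, ite_smul, Finset.sum_ite_mem]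
  · intro i _
    refine Integrable.smul_measure (integrable_dirac (by simp)) ?_
    by_cases h : i ∈ (↑s : Set γ) <;> simp [h]

open Finset in
open scoped BigOperators in
lemma aux_fiber {ι κ M : Type*} [DecidableEq κ] [AddCommMonoid M] [Module ℚ≥0 M]
    (s : Finset ι) (z : ι → κ) (h : ι → M) :
    𝔼 x ∈ s, h x = 𝔼 x ∈ s, 𝔼 x' ∈ s with z x' = z x, h x' := by
  simp only [Finset.expect, Finset.smul_sum]
  have := Finset.sum_comm' (s := s) (t := fun x => s.filter fun x' => z x' = z x)
    (t' := s) (s' := fun x => s.filter fun x' => z x' = z x)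
    (f := fun x x' => (#s : ℚ≥0)⁻¹ • (#(s.filter fun y => z y = z x) : ℚ≥0)⁻¹ • h x')
    (by intro x y; simp only [mem_filter]; constructor <;> (rintro ⟨a, b⟩; simp_all))
  rw [this]
  refine Finset.sum_congr rfl fun x hx => ?_
  have h2 : ∀ y ∈ s.filter (fun x' => z x' = z x),
      (#s : ℚ≥0)⁻¹ • (#(s.filter fun y' => z y' = z y) : ℚ≥0)⁻¹ • h x
      = (#s : ℚ≥0)⁻¹ • (#(s.filter fun y' => z y' = z x) : ℚ≥0)⁻¹ • h x := by
    intro y hy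
    rw [(mem_filter.1 hy).2]
  rw [Finset.sum_congr rfl h2, Finset.sum_const, ← Nat.cast_smul_eq_nsmul ℚ≥0, smul_comm,
    smul_inv_smul₀]
  have : x ∈ s.filter (fun y' => z y' = z x) := by simp [hx]
  exact_mod_cast (card_pos.2 ⟨x, this⟩).ne'

open Finset in
open scoped BigOperators in
lemma aux_jensen {ι : Type*} (s : Finset ι) (f : ι → ℝ) (hf : ∀ i ∈ s, 0 ≤ f i) (m : ℕ)
    (hm : m ≠ 0) : (𝔼 i ∈ s, f i) ^ m ≤ 𝔼 i ∈ s, f i ^ m := by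
  rcases s.eq_empty_or_nonempty with rfl | hs
  · simp [hm]
  have hc : (0 : ℝ) < #s := by exact_mod_cast hs.card_pos
  have := Real.pow_arith_mean_le_arith_mean_pow s (fun _ => (#s : ℝ)⁻¹) f
    (fun _ _ => by positivity) (by simp [hc.ne']) hf m
  simpa [expect_eq_sum_div_card, div_eq_inv_mul, Finset.mul_sum] using this

open Finset in
open scoped BigOperators in
lemma aux_cs {ι κ : Type*} (P : Finset ι) (T : Finset κ) (G : ι → κ → ℂ) :
    ‖𝔼 p ∈ P, 𝔼 a ∈ T, G p a‖ ^ 2 ≤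
      𝔼 a ∈ T, 𝔼 b ∈ T, ‖𝔼 p ∈ P, G p a * (starRingEnd ℂ) (G p b)‖ := by
  have h1 : ‖𝔼 p ∈ P, 𝔼 a ∈ T, G p a‖ ^ 2 ≤ 𝔼 p ∈ P, ‖𝔼 a ∈ T, G p a‖ ^ 2 := by
    refine le_trans ?_ (aux_jensen P _ (fun _ _ => norm_nonneg _) 2 two_ne_zero)
    gcongr
    exact RCLike.norm_expect_le (K := ℂ)
  have h2 : ((𝔼 p ∈ P, ‖𝔼 a ∈ T, G p a‖ ^ 2 : ℝ) : ℂ) =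
      𝔼 a ∈ T, 𝔼 b ∈ T, 𝔼 p ∈ P, G p a * (starRingEnd ℂ) (G p b) := by
    have e1 : ((𝔼 p ∈ P, ‖𝔼 a ∈ T, G p a‖ ^ 2 : ℝ) : ℂ)
        = 𝔼 p ∈ P, (((‖𝔼 a ∈ T, G p a‖ ^ 2 : ℝ)) : ℂ) := RCLike.ofReal_expect (K := ℂ) _ _
    rw [e1]
    have e2 : ∀ p ∈ P, (((‖𝔼 a ∈ T, G p a‖ ^ 2 : ℝ)) : ℂ) =
        𝔼 a ∈ T, 𝔼 b ∈ T, G p a * (starRingEnd ℂ) (G p b) := by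
      intro p _
      rw [← Finset.expect_mul_expect]
      have : 𝔼 b ∈ T, (starRingEnd ℂ) (G p b) = (starRingEnd ℂ) (𝔼 b ∈ T, G p b) := by
        simp [expect_eq_sum_div_card]
      rw [this, Complex.mul_conj, Complex.normSq_eq_norm_sq]
    rw [Finset.expect_congr rfl e2, Finset.expect_comm]
    refine Finset.expect_congr rfl fun a _ => ?_
    rw [Finset.expect_comm]
  calc _ ≤ _ := h1
    _ ≤ ‖((𝔼 p ∈ P, ‖𝔼 a ∈ T, G p a‖ ^ 2 : ℝ) : ℂ)‖ := by
      rw [Complex.norm_real]; exact Real.le_norm_self _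
    _ ≤ _ := by
      rw [h2]
      refine (RCLike.norm_expect_le (K := ℂ)).trans (Finset.expect_le_expect fun a _ => ?_)
      exact RCLike.norm_expect_le (K := ℂ)

open Finset in
open scoped BigOperators in
lemma aux_cons {γ M : Type*} [AddCommMonoid M] [Module ℚ≥0 M] {k : ℕ}
    (T : Fin (k + 1) → Finset γ) (h : (Fin (k + 1) → γ) → M) :
    𝔼 y ∈ Fintype.piFinset T, h y =
      𝔼 a ∈ T 0, 𝔼 y ∈ Fintype.piFinset (fun j => T j.succ), h (Fin.cons a y) := by
  rw [← Finset.expect_product' (T 0) _ (fun a y => h (Fin.cons a y))]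
  refine Finset.expect_nbij' (fun y => (y 0, Fin.tail y)) (fun p => Fin.cons p.1 p.2) ?_ ?_ ?_ ?_ ?_
  · intro y hy
    simp only [Fintype.mem_piFinset, mem_product] at *
    exact ⟨hy 0, fun j => hy j.succ⟩
  · intro p hp
    simp only [Fintype.mem_piFinset, mem_product] at *
    intro j
    refine Fin.cases ?_ (fun j => ?_) j
    · exact hp.1
    · exact hp.2 j
  · intro y _; simp
  · intro p _; simp
  · intro y _; simp

lemma aux_sign {k : ℕ} (F : (Fin (k + 1) → Bool) → ℝ) :
    ∑ v : Fin (k + 1) → Bool,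
      (-1 : ℝ) ^ (Finset.univ.filter fun j => v j = true).card * F v =
    ∑ v : Fin k → Bool,
      (-1 : ℝ) ^ (Finset.univ.filter fun j => v j = true).card *
        (F (Fin.cons false v) - F (Fin.cons true v)) := by
  have hs : ∀ (m : ℕ) (v : Fin m → Bool),
      (-1 : ℝ) ^ (Finset.univ.filter fun j => v j = true).card
        = ∏ j, if v j = true then (-1 : ℝ) else 1 := by
    intro m v
    simp [Finset.prod_ite]
  simp only [hs]
  rw [← (Fin.consEquiv (fun _ => Bool)).sum_comp, Fintype.sum_prod_type]
  simp only [Fin.consEquiv, Fintype.sum_bool, Equiv.coe_fn_mk, Fin.prod_univ_succ, Fin.cons_zero,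
    Fin.cons_succ]
  rw [← Finset.sum_add_distrib]
  refine Finset.sum_congr rfl fun v _ => ?_
  simp
  ring

open Finset in
open scoped BigOperators in
lemma aux_box {γ Ω : Type*} (U : Finset Ω) (k : ℕ) : ∀ (T : Fin k → Finset γ)
    (F : (Fin k → γ) → Ω → ℝ),
    ‖𝔼 u ∈ U, 𝔼 y ∈ Fintype.piFinset T, Complex.exp (Complex.I * Complex.ofReal (F y u))‖ ^ (2 ^ k)
     ≤ 𝔼 y0 ∈ Fintype.piFinset T, 𝔼 y1 ∈ Fintype.piFinset T,
      ‖𝔼 u ∈ U, Complex.exp (Complex.I * Complex.ofReal (∑ v : Fin k → Bool,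
        (-1 : ℝ) ^ (Finset.univ.filter fun j => v j = true).card *
          F (fun j => if v j then y1 j else y0 j) u))‖ := by
  induction k with
  | zero =>
    intro T F
    have hT : Fintype.piFinset T = {fun i => i.elim0} := by
      ext y
      rw [Subsingleton.elim y (fun i => i.elim0)]
      simp only [Fintype.mem_piFinset, mem_singleton, iff_true]
      exact fun i => i.elim0
    rw [hT]
    simp only [expect_singleton, pow_zero, pow_one, Finset.univ_unique, Finset.sum_singleton,
      Finset.univ_eq_empty, Finset.filter_empty, Finset.card_empty, one_mul]
    refine le_of_eq ?_
    congr 1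
    refine Finset.expect_congr rfl fun u _ => ?_
    congr 5
    exact Subsingleton.elim _ _
  | succ k ih =>
    intro T F
    set T' : Fin k → Finset γ := fun j => T j.succ with hT'
    have hstart : 𝔼 u ∈ U, 𝔼 y ∈ Fintype.piFinset T,
          Complex.exp (Complex.I * Complex.ofReal (F y u)) =
        𝔼 p ∈ U ×ˢ Fintype.piFinset T', 𝔼 a ∈ T 0,
          Complex.exp (Complex.I * Complex.ofReal (F (Fin.cons a p.2) p.1)) := by
      rw [Finset.expect_product]
      refine Finset.expect_congr rfl fun u _ => ?_
      rw [aux_cons, Finset.expect_comm]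
    rw [hstart, pow_succ', pow_mul]
    have h1 := aux_cs (U ×ˢ Fintype.piFinset T') (T 0)
      (fun p a => Complex.exp (Complex.I * Complex.ofReal (F (Fin.cons a p.2) p.1)))
    refine (pow_le_pow_left₀ (by positivity) h1 _).trans ?_
    refine (aux_jensen _ _ (fun _ _ => expect_nonneg fun _ _ => norm_nonneg _) _
      (by positivity)).trans ?_
    have h2 : ∀ a ∈ T 0, (𝔼 b ∈ T 0, ‖𝔼 p ∈ U ×ˢ Fintype.piFinset T',
        Complex.exp (Complex.I * Complex.ofReal (F (Fin.cons a p.2) p.1)) *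
        (starRingEnd ℂ) (Complex.exp (Complex.I * Complex.ofReal (F (Fin.cons b p.2) p.1)))‖)
          ^ (2 ^ k) ≤ 𝔼 b ∈ T 0, 𝔼 y0 ∈ Fintype.piFinset T', 𝔼 y1 ∈ Fintype.piFinset T',
      ‖𝔼 u ∈ U, Complex.exp (Complex.I * Complex.ofReal (∑ v : Fin k → Bool,
        (-1 : ℝ) ^ (Finset.univ.filter fun j => v j = true).card *
          (F (Fin.cons a (fun j => if v j then y1 j else y0 j)) u -
            F (Fin.cons b (fun j => if v j then y1 j else y0 j)) u)))‖ := by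
      intro a _
      refine (aux_jensen _ _ (fun _ _ => norm_nonneg _) _ (by positivity)).trans ?_
      refine Finset.expect_le_expect fun b _ => ?_
      refine le_trans (le_of_eq ?_) (ih T' (fun y u => F (Fin.cons a y) u - F (Fin.cons b y) u))
      congr 2
      rw [Finset.expect_product]
      refine Finset.expect_congr rfl fun u _ => Finset.expect_congr rfl fun y _ => ?_
      rw [← Complex.exp_conj, ← Complex.exp_add]
      congr 1
      simp
      ring
    refine (Finset.expect_le_expect h2).trans (le_of_eq ?_)
    rw [aux_cons]
    refine Finset.expect_congr rfl fun a _ => ?_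
    rw [Finset.expect_comm]
    refine Finset.expect_congr rfl fun y0 _ => ?_
    rw [aux_cons]
    refine Finset.expect_congr rfl fun b _ => Finset.expect_congr rfl fun y1 _ => ?_
    congr 1
    refine Finset.expect_congr rfl fun u _ => ?_
    rw [aux_sign]
    congr 3
    refine Finset.sum_congr rfl fun v _ => ?_
    have key : ∀ c : Bool, (fun j : Fin (k + 1) =>
        if (Fin.cons c v : Fin (k + 1) → Bool) j = true then (Fin.cons b y1 : Fin (k + 1) → γ) j
          else (Fin.cons a y0 : Fin (k + 1) → γ) j) =
        Fin.cons (if c = true then b else a) (fun j => if v j = true then y1 j else y0 j) := by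
      intro c
      funext j
      refine Fin.cases ?_ (fun j => ?_) j <;> simp
    rw [key, key]
    simp

lemma aux_glue_A {n k : ℕ} (A : Finset (Fin n)) (B : Fin k → Finset (Fin n))
    (u : Fin n → Bool) (y : Fin k → Fin n → Bool) (i : Fin n) (hi : i ∈ A) :
    glue A B u y i = u i := by simp [glue, hi]

lemma aux_glue_B {n k : ℕ} (A : Finset (Fin n)) (B : Fin k → Finset (Fin n))
    (hdAB : ∀ j, Disjoint A (B j)) (hdBB : ∀ j j', j ≠ j' → Disjoint (B j) (B j'))
    (u : Fin n → Bool) (y : Fin k → Fin n → Bool) (j : Fin k) (i : Fin n) (hi : i ∈ B j) :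
    glue A B u y i = y j i := by
  have hA : i ∉ A := fun h => Finset.disjoint_left.1 (hdAB j) h hi
  simp only [glue, hA, if_false]
  apply le_antisymm
  · refine Finset.sup_le fun j' _ => ?_
    by_cases h : j' = j
    · subst h; simp [hi]
    · have : i ∉ B j' := fun h' => Finset.disjoint_left.1 (hdBB j' j h) h' hi
      simp [this]
  · have := Finset.le_sup (f := fun j => if i ∈ B j then y j i else false) (Finset.mem_univ j)
    simpa [hi] using this

lemma aux_card {n k : ℕ} (A : Finset (Fin n)) (B : Fin k → Finset (Fin n))
    (hdAB : ∀ j, Disjoint A (B j)) (hdBB : ∀ j j', j ≠ j' → Disjoint (B j) (B j'))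
    (hcov : ∀ i : Fin n, i ∈ A ∨ ∃ j, i ∈ B j) (x : Fin n → Bool) :
    (Finset.univ.filter fun i => x i = true).card = (A.filter fun i => x i = true).card +
      ∑ j, ((B j).filter fun i => x i = true).card := by
  have hu : (Finset.univ : Finset (Fin n)) = A ∪ Finset.univ.biUnion B := by
    ext i; simpa using hcov i
  simp only [Finset.card_filter]
  rw [hu, Finset.sum_union, Finset.sum_biUnion]
  · intro j _ j' _ h; exact hdBB j j' h
  · rw [Finset.disjoint_biUnion_right]; exact fun j _ => hdAB j

lemma aux_card_congr {n : ℕ} (C : Finset (Fin n)) (x x' : Fin n → Bool)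
    (h : ∀ i ∈ C, x i = x' i) :
    (C.filter fun i => x i = true).card = (C.filter fun i => x' i = true).card := by
  congr 1
  exact Finset.filter_congr fun i hi => by rw [h i hi]

open Finset in
open scoped BigOperators in
lemma aux_bij {M : Type*} [AddCommMonoid M] [Module ℚ≥0 M]
    (n k S : ℕ) (A : Finset (Fin n)) (B : Fin k → Finset (Fin n))
    (hdAB : ∀ j, Disjoint A (B j)) (hdBB : ∀ j j', j ≠ j' → Disjoint (B j) (B j'))
    (hcov : ∀ i : Fin n, i ∈ A ∨ ∃ j, i ∈ B j)
    (E : Finset (Fin n → Bool))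
    (hE : ∀ x, x ∈ E ↔ (Finset.univ.filter fun i => x i = true).card = S)
    (x : Fin n → Bool) (hx : x ∈ E)
    (U : Finset (Fin n → Bool)) (hU : ∀ u, u ∈ U ↔ (∀ i ∉ A, u i = false) ∧
                  (A.filter fun i => u i = true).card =
                    S - ∑ j, ((B j).filter fun i => x i = true).card)
    (T : Fin k → Finset (Fin n → Bool))
    (hT : ∀ j y, y ∈ T j ↔ (∀ i ∉ B j, y i = false) ∧
                ((B j).filter fun i => y i = true).card =
                  ((B j).filter fun i => x i = true).card)
    (h : (Fin n → Bool) → M) :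
    𝔼 x' ∈ E with (fun j => ((B j).filter fun i => x' i = true).card) =
        (fun j => ((B j).filter fun i => x i = true).card), h x' =
      𝔼 u ∈ U, 𝔼 y ∈ Fintype.piFinset T, h (glue A B u y) := by
  rw [← Finset.expect_product' U _ (fun u y => h (glue A B u y))]
  have hgr : ∀ x' : Fin n → Bool, glue A B (fun i => if i ∈ A then x' i else false)
      (fun j i => if i ∈ B j then x' i else false) = x' := by
    intro x'
    funext i
    rcases hcov i with hi | ⟨j, hi⟩
    · rw [aux_glue_A A B _ _ i hi]; simp [hi]
    · rw [aux_glue_B A B hdAB hdBB _ _ j i hi]; simp [hi]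
  have hcx := aux_card A B hdAB hdBB hcov x
  rw [(hE x).1 hx] at hcx
  refine Finset.expect_nbij' (fun x' => (fun i => if i ∈ A then x' i else false,
      fun j i => if i ∈ B j then x' i else false)) (fun p => glue A B p.1 p.2) ?_ ?_ ?_ ?_ ?_
  · intro x' hx'
    simp only [mem_filter, hE] at hx'
    obtain ⟨h1, h2⟩ := hx'
    simp only [mem_product, Fintype.mem_piFinset, hU, hT]
    refine ⟨⟨fun i hi => by simp [hi], ?_⟩, fun j => ⟨fun i hi => by simp [hi], ?_⟩⟩
    · rw [aux_card_congr A _ x' (fun i hi => by simp [hi])]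
      have := aux_card A B hdAB hdBB hcov x'
      rw [h1, Finset.sum_congr rfl (fun j _ => congrFun h2 j)] at this
      omega
    · rw [aux_card_congr (B j) _ x' (fun i hi => by simp [hi])]
      exact congrFun h2 j
  · rintro ⟨u, y⟩ hp
    simp only [mem_product, Fintype.mem_piFinset, hU, hT] at hp
    obtain ⟨⟨h1, h2⟩, h3⟩ := hp
    have hB : ∀ j, ((B j).filter fun i => glue A B u y i = true).card =
        ((B j).filter fun i => x i = true).card := by
      intro j
      rw [aux_card_congr (B j) _ (y j) (fun i hi => aux_glue_B A B hdAB hdBB u y j i hi)]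
      exact (h3 j).2
    simp only [mem_filter, hE]
    refine ⟨?_, funext hB⟩
    rw [aux_card A B hdAB hdBB hcov, Finset.sum_congr rfl (fun j _ => hB j),
      aux_card_congr A _ u (fun i hi => aux_glue_A A B u y i hi), h2]
    omega
  · intro x' _
    exact hgr x'
  · rintro ⟨u, y⟩ hp
    simp only [mem_product, Fintype.mem_piFinset, hU, hT] at hp
    obtain ⟨⟨h1, h2⟩, h3⟩ := hp
    refine Prod.ext ?_ ?_
    · funext i
      by_cases hi : i ∈ A
      · simp [hi, aux_glue_A A B u y i hi]
      · simp [hi, h1 i hi]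
    · funext j i
      by_cases hi : i ∈ B j
      · simp [hi, aux_glue_B A B hdAB hdBB u y j i hi]
      · simp [hi, (h3 j).1 i hi]
  · intro x' _
    simp only [hgr]

theorem decoupling_slice
    (n k S : ℕ) (hS : S ≤ n) (A : Finset (Fin n)) (B : Fin k → Finset (Fin n))
    (hdAB : ∀ j, Disjoint A (B j)) (hdBB : ∀ j j', j ≠ j' → Disjoint (B j) (B j'))
    (hcov : ∀ i : Fin n, i ∈ A ∨ ∃ j, i ∈ B j)
    (f : (Fin n → Bool) → ℝ) (t : ℝ) :
    let slice := finUniform {x : Fin n → Bool |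
      (Finset.univ.filter fun i => x i = true).card = S}
    ‖∫ x, Complex.exp (Complex.I * Complex.ofReal (t * f x)) ∂slice‖ ^ (2 ^ k)
      ≤ ∫ x,
          (∫ y1, ‖∫ xA, Complex.exp (Complex.I * Complex.ofReal
                (t * alphaSlice A B f xA fun j b =>
                  if b then y1 j else fun i => if i ∈ B j then x i else false))
              ∂(finUniform {u : Fin n → Bool |
                  (∀ i ∉ A, u i = false) ∧
                  (A.filter fun i => u i = true).card =
                    S - ∑ j, ((B j).filter fun i => x i = true).card})‖
            ∂(finUniform {y : Fin k → Fin n → Bool | ∀ j,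
                (∀ i ∉ B j, y j i = false) ∧
                ((B j).filter fun i => y j i = true).card =
                  ((B j).filter fun i => x i = true).card}))
          ∂slice := by
  classical
  intro slice
  let E : Finset (Fin n → Bool) :=
    Finset.univ.filter fun x => (Finset.univ.filter fun i => x i = true).card = S
  let U : (Fin n → Bool) → Finset (Fin n → Bool) := fun x =>
    Finset.univ.filter fun u => (∀ i ∉ A, u i = false) ∧
                  (A.filter fun i => u i = true).card =
                    S - ∑ j, ((B j).filter fun i => x i = true).card
  let T : (Fin n → Bool) → Fin k → Finset (Fin n → Bool) := fun x j =>
    Finset.univ.filter fun y => (∀ i ∉ B j, y i = false) ∧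
                ((B j).filter fun i => y i = true).card =
                  ((B j).filter fun i => x i = true).card
  have hE : ∀ x, x ∈ E ↔ (Finset.univ.filter fun i => x i = true).card = S := by
    intro x; simp [E]
  let z : (Fin n → Bool) → Fin k → ℕ := fun x j => ((B j).filter fun i => x i = true).card
  have hz : ∀ x x', z x' = z x → U x' = U x ∧ T x' = T x := by
    intro x x' h
    have h' : ∀ j, ((B j).filter fun i => x' i = true).card =
      ((B j).filter fun i => x i = true).card := fun j => congrFun h j
    constructor
    · simp only [U, h']
    · simp only [T, h']
  have hbC := fun x hx => aux_bij (M := ℂ) n k S A B hdAB hdBB hcov E hE x hx (U x)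
    (by intro u; simp [U]) (T x) (by intro j y; simp [T])
  have hbR := fun x hx => aux_bij (M := ℝ) n k S A B hdAB hdBB hcov E hE x hx (U x)
    (by intro u; simp [U]) (T x) (by intro j y; simp [T])
  -- finite form of the integrals
  have hL : ∀ g : (Fin n → Bool) → ℂ, ∫ x, g x ∂slice = Finset.expect E g := fun g =>
    aux_integral E _ (fun x => (hE x).symm) g
  have hR : ∀ g : (Fin n → Bool) → ℝ, ∫ x, g x ∂slice = Finset.expect E g := fun g =>
    aux_integral E _ (fun x => (hE x).symm) g
  rw [hL, hR]
  have hin : ∀ x, (∀ g : (Fin n → Bool) → ℂ, ∫ u, g u ∂(finUniform {u : Fin n → Bool |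
                  (∀ i ∉ A, u i = false) ∧
                  (A.filter fun i => u i = true).card =
                    S - ∑ j, ((B j).filter fun i => x i = true).card}) =
                    Finset.expect (U x) g) := fun x g =>
    aux_integral (U x) _ (fun u => by simp [U]) g
  have hmid : ∀ x, (∀ g : (Fin k → Fin n → Bool) → ℝ,
      ∫ y, g y ∂(finUniform {y : Fin k → Fin n → Bool | ∀ j,
                (∀ i ∉ B j, y j i = false) ∧
                ((B j).filter fun i => y j i = true).card =
                  ((B j).filter fun i => x i = true).card}) =
                    Finset.expect (Fintype.piFinset (T x)) g) := fun x g =>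
    aux_integral (Fintype.piFinset (T x)) _ (fun u => by simp [T]) g
  simp only [hin, hmid]
  let H : (Fin n → Bool) → (Fin k → Fin n → Bool) → ℝ := fun x y0 =>
    Finset.expect (Fintype.piFinset (T x)) fun y1 => ‖Finset.expect (U x) fun u =>
      Complex.exp (Complex.I * Complex.ofReal
        (t * alphaSlice A B f u fun j b => if b then y1 j else y0 j))‖
  have hUne : ∀ x ∈ E, (U x).Nonempty := by
    intro x hx
    refine ⟨fun i => if i ∈ A then x i else false, ?_⟩
    have hcx := aux_card A B hdAB hdBB hcov x
    rw [(hE x).1 hx] at hcx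
    simp only [U, Finset.mem_filter, Finset.mem_univ, true_and]
    refine ⟨fun i hi => by simp [hi], ?_⟩
    rw [aux_card_congr A _ x (fun i hi => by simp [hi])]
    omega
  have hRHS : (Finset.expect E fun x => H x (fun j i => if i ∈ B j then x i else false)) =
      Finset.expect E fun x => Finset.expect (Fintype.piFinset (T x)) (H x) := by
    rw [aux_fiber E z]
    refine Finset.expect_congr rfl fun x hx => ?_
    have e1 : ∀ x' ∈ E.filter (fun x' => z x' = z x),
        H x' (fun j i => if i ∈ B j then x' i else false) =
        H x (fun j i => if i ∈ B j then x' i else false) := by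
      intro x' hx'
      obtain ⟨a, b⟩ := hz x x' (Finset.mem_filter.1 hx').2
      simp only [H, a, b]
    rw [Finset.expect_congr rfl e1]
    refine (hbR x hx (fun x' => H x (fun j i => if i ∈ B j then x' i else false))).trans ?_
    rw [Finset.expect_congr rfl (g := fun _ => Finset.expect (Fintype.piFinset (T x)) (H x)),
      Finset.expect_const (hUne x hx)]
    intro u _
    refine Finset.expect_congr rfl fun y hy => ?_
    congr 1
    funext j i
    have hyj := Fintype.mem_piFinset.1 hy j
    simp only [T, Finset.mem_filter, Finset.mem_univ, true_and] at hyj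
    by_cases hi : i ∈ B j
    · simp [hi, aux_glue_B A B hdAB hdBB u y j i hi]
    · simp [hi, hyj.1 i hi]
  have hfin : (Finset.expect E fun x => H x (fun j i => if i ∈ B j then x i else false)) ≥
      ‖Finset.expect E fun x => Complex.exp (Complex.I * Complex.ofReal (t * f x))‖ ^ (2 ^ k) := by
    rw [hRHS, aux_fiber E z (fun x => Complex.exp (Complex.I * Complex.ofReal (t * f x)))]
    refine (pow_le_pow_left₀ (norm_nonneg _) (RCLike.norm_expect_le (K := ℂ)) _).trans ?_
    refine (aux_jensen _ _ (fun _ _ => norm_nonneg _) _ (by positivity)).trans ?_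
    refine Finset.expect_le_expect fun x hx => ?_
    have e := hbC x hx (fun x' => Complex.exp (Complex.I * Complex.ofReal (t * f x')))
    have b := aux_box (U x) k (T x) (fun y u => t * f (glue A B u y))
    rw [← e] at b
    refine b.trans (le_of_eq ?_)
    refine Finset.expect_congr rfl fun y0 _ => Finset.expect_congr rfl fun y1 _ => ?_
    congr 1
    refine Finset.expect_congr rfl fun u _ => ?_
    congr 3
    rw [alphaSlice, Finset.mul_sum]
    refine Finset.sum_congr rfl fun v _ => ?_
    ring
  exact hfin
end

section
/- Fix ℓ ≥ 3 and λ ∈ (0,1/2), and let W be an (ℓ,λ)-graph statistic in which the edge indicators x_e are i.i.d. Bernoulli(p) with p ∈ (λ, 1−λ) (the G(n,p) model). Let W_3 be its order-3 portion and σ the standard deviation of W_3. Then there is a constant C depending only on ℓ and λ such that for all n ≥ 3, sup_f |E[f(W_3/σ)] − E[f(Z)]| ≤ C/√n, where the supremum is over all 1-Lipschitz functions f: ℝ → ℝ and Z is a standard Gaussian random variable; that is, the Wasserstein distance between W_3/σ and 𝒩(0,1) is at most C/√n. -/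
open MeasureTheory ProbabilityTheory
open scoped ENNReal NNReal

noncomputable section

/-- The product Bernoulli(p) measure on `ι → Bool`. -/
def bernoulliPi (ι : Type*) [Fintype ι] [DecidableEq ι] (p : ℝ) : Measure (ι → Bool) :=
  ∑ x : ι → Bool, (∏ i : ι, ENNReal.ofReal (if x i then p else 1 - p)) • Measure.dirac x

/-- The Erdős–Rényi G(n,p) measure, as a measure on edge-indicator functions. -/
def gnp (n : ℕ) (p : ℝ) : Measure (Sym2 (Fin n) → Bool) := bernoulliPi _ p

/-- The G(n,m) measure: uniform over edge-indicator functions with exactly `m` edges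
(diagonal coordinates forced to `false`). -/
def gnm (n m : ℕ) : Measure (Sym2 (Fin n) → Bool) :=
  finUniform {x | (∀ e : Sym2 (Fin n), e.IsDiag → x e = false) ∧
    (Finset.univ.filter fun e : Sym2 (Fin n) => x e = true).card = m}

open Classical in
/-- The graph factor `γ_H(x) = Σ_{E ≅ H} Π_{e ∈ E} χ_e`, where
`χ_e = (x_e − p)/√(p(1−p))`, and the sum is over edge sets `E` spanning a copy of `H`. -/
def graphFactor {β : Type*} [Fintype β] (H : SimpleGraph β) (p : ℝ) {n : ℕ}
    (x : Sym2 (Fin n) → Bool) : ℝ :=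
  ∑ E : Finset (Sym2 (Fin n)),
    if ∃ f : β ↪ Fin n, (↑E : Set (Sym2 (Fin n))) = Sym2.map f '' H.edgeSet then
      ∏ e ∈ E, (((if x e then (1 : ℝ) else 0) - p) / Real.sqrt (p * (1 - p)))
    else 0

/-- The `(ℓ,λ)`-graph statistic `W = Σ_{H ∈ ℋ} n^{ℓ−v(H)} Δ_H γ_H(x)`, where graphs on at
most `ℓ` vertices with no isolated vertices are represented as graphs on `Fin ℓ` padded with
isolated vertices, and `v(H) = Nat.card H.support` is the number of non-isolated vertices. -/
def graphStat (ℓ : ℕ) (ℋ : Finset (SimpleGraph (Fin ℓ))) (Δ : SimpleGraph (Fin ℓ) → ℝ)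
    (p : ℝ) {n : ℕ} (x : Sym2 (Fin n) → Bool) : ℝ :=
  ∑ G ∈ ℋ, (n : ℝ) ^ (ℓ - Nat.card G.support) * Δ G * graphFactor G p x

/-- The order-`k` portion `W_k` of an `(ℓ,λ)`-graph statistic: the terms with `v(H) = k`. -/
def graphStatPart (ℓ : ℕ) (ℋ : Finset (SimpleGraph (Fin ℓ))) (Δ : SimpleGraph (Fin ℓ) → ℝ)
    (p : ℝ) (kk : ℕ) {n : ℕ} (x : Sym2 (Fin n) → Bool) : ℝ :=
  ∑ G ∈ ℋ.filter fun G => Nat.card G.support = kk,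
    (n : ℝ) ^ (ℓ - Nat.card G.support) * Δ G * graphFactor G p x

/-- The data of an `(ℓ,λ)`-factor system: `ℋ` is a set of pairwise non-isomorphic graphs
(with no isolated vertices, padded to `Fin ℓ`), `ℋ' ⊆ ℋ` contains a connected graph on `k`
vertices for every `3 ≤ k ≤ ℓ`, and the coefficients satisfy `|Δ_H| ≤ 1/λ` on `ℋ` and
`|Δ_H| ≥ λ` on `ℋ'`. -/
def IsFactorSystem (ℓ : ℕ) (lam : ℝ) (ℋ ℋ' : Finset (SimpleGraph (Fin ℓ)))
    (Δ : SimpleGraph (Fin ℓ) → ℝ) : Prop :=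
  ℋ' ⊆ ℋ ∧
  (∀ G₁ ∈ ℋ, ∀ G₂ ∈ ℋ, Nonempty (G₁ ≃g G₂) → G₁ = G₂) ∧
  (∀ kk : ℕ, 3 ≤ kk → kk ≤ ℓ →
    ∃ G ∈ ℋ', (G.induce G.support).Connected ∧ Nat.card G.support = kk) ∧
  (∀ G ∈ ℋ, |Δ G| ≤ 1 / lam) ∧ (∀ G ∈ ℋ', lam ≤ |Δ G|)

end


open MeasureTheory ProbabilityTheory
open scoped ENNReal NNReal

set_option linter.unusedSectionVars false
set_option linter.unusedVariables false

namespace GSW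
noncomputable section

variable {ι : Type*} [Fintype ι] [DecidableEq ι]

def wt (p : ℝ) (b : Bool) : ℝ := if b then p else 1 - p

def Ex (p : ℝ) (F : (ι → Bool) → ℝ) : ℝ := ∑ x : ι → Bool, (∏ i, wt p (x i)) * F x

def Ei (p : ℝ) (i : ι) (F : (ι → Bool) → ℝ) (x : ι → Bool) : ℝ :=
  p * F (Function.update x i true) + (1 - p) * F (Function.update x i false)

def Ind (i : ι) (F : (ι → Bool) → ℝ) : Prop := ∀ x b, F (Function.update x i b) = F x

def chi (p : ℝ) (b : Bool) : ℝ := ((if b then (1 : ℝ) else 0) - p) / Real.sqrt (p * (1 - p))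

theorem Ex_add (p : ℝ) (F H : (ι → Bool) → ℝ) :
    Ex p (fun x => F x + H x) = Ex p F + Ex p H := by
  simp [Ex, mul_add, Finset.sum_add_distrib]

theorem Ex_sub (p : ℝ) (F H : (ι → Bool) → ℝ) :
    Ex p (fun x => F x - H x) = Ex p F - Ex p H := by
  simp [Ex, mul_sub, Finset.sum_sub_distrib]

theorem Ex_mul (p : ℝ) (a : ℝ) (F : (ι → Bool) → ℝ) :
    Ex p (fun x => a * F x) = a * Ex p F := by
  simp only [Ex, Finset.mul_sum]
  exact Finset.sum_congr rfl fun x _ => by ring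

theorem Ex_sum {κ : Type*} (p : ℝ) (s : Finset κ) (F : κ → (ι → Bool) → ℝ) :
    Ex p (fun x => ∑ k ∈ s, F k x) = ∑ k ∈ s, Ex p (F k) := by
  simp only [Ex, Finset.mul_sum]
  exact Finset.sum_comm

theorem sum_wt (p : ℝ) : ∑ x : ι → Bool, ∏ i, wt p (x i) = 1 := by
  rw [← Fintype.prod_sum (fun (_ : ι) b => wt p b)]
  simp [wt]

theorem Ex_const (p : ℝ) (a : ℝ) : Ex (ι := ι) p (fun _ => a) = a := by
  simp only [Ex, ← Finset.sum_mul, sum_wt, one_mul]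

theorem wt_nonneg {p : ℝ} (h0 : 0 ≤ p) (h1 : p ≤ 1) (b : Bool) : 0 ≤ wt p b := by
  unfold wt; split_ifs <;> linarith

theorem Ex_mono {p : ℝ} (h0 : 0 ≤ p) (h1 : p ≤ 1) {F H : (ι → Bool) → ℝ}
    (h : ∀ x, F x ≤ H x) : Ex p F ≤ Ex p H :=
  Finset.sum_le_sum fun x _ => mul_le_mul_of_nonneg_left (h x)
    (Finset.prod_nonneg fun i _ => wt_nonneg h0 h1 _)

theorem Ex_nonneg {p : ℝ} (h0 : 0 ≤ p) (h1 : p ≤ 1) {F : (ι → Bool) → ℝ}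
    (h : ∀ x, 0 ≤ F x) : 0 ≤ Ex p F := by
  have := Ex_mono (ι := ι) h0 h1 h
  rwa [Ex_const] at this

theorem Ex_abs {p : ℝ} (h0 : 0 ≤ p) (h1 : p ≤ 1) (F : (ι → Bool) → ℝ) :
    |Ex p F| ≤ Ex p (fun x => |F x|) := by
  unfold Ex
  refine (Finset.abs_sum_le_sum_abs _ _).trans (le_of_eq ?_)
  refine Finset.sum_congr rfl fun x _ => ?_
  rw [abs_mul, abs_of_nonneg (Finset.prod_nonneg fun i _ => wt_nonneg h0 h1 _)]

/-- Jensen: first moment squared. -/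
theorem Ex_sq_le {p : ℝ} (h0 : 0 ≤ p) (h1 : p ≤ 1) (F : (ι → Bool) → ℝ) :
    (Ex p F) ^ 2 ≤ Ex p (fun x => F x ^ 2) := by
  have h : 0 ≤ Ex p (fun x => (F x - Ex p F) ^ 2) :=
    Ex_nonneg h0 h1 fun x => sq_nonneg _
  have e : (fun x => (F x - Ex p F) ^ 2) =
      fun x => (F x ^ 2 - 2 * Ex p F * F x) + (Ex p F) ^ 2 := by
    funext x; ring
  rw [e, Ex_add, Ex_sub, Ex_const, Ex_mul p (2 * Ex p F) F] at h
  nlinarith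

theorem Ex_Ei (p : ℝ) (i : ι) (F : (ι → Bool) → ℝ) : Ex p (Ei p i F) = Ex p F := by
  rw [← sub_eq_zero, ← Ex_sub]
  unfold Ex
  refine Finset.sum_involution (fun x _ => Function.update x i (!(x i))) ?_ ?_ ?_ ?_
  · intro x _
    have e : ∀ b, ∏ j, wt p (Function.update x i b j) = wt p b * ∏ j ∈ Finset.univ.erase i, wt p (x j) := by
      intro b
      rw [← Finset.mul_prod_erase _ _ (Finset.mem_univ i)]
      simp only [Function.update_self]
      congr 1
      refine Finset.prod_congr rfl fun j hj => ?_
      rw [Function.update_of_ne (Finset.ne_of_mem_erase hj)]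
    have e2 := e (x i)
    rw [Function.update_eq_self] at e2
    rw [e, e2]
    unfold Ei
    simp only [Function.update_idem]
    have hx : Function.update x i (x i) = x := Function.update_eq_self _ _
    cases hxi : x i
    · rw [hxi] at hx
      rw [hx]; simp [wt]; ring
    · rw [hxi] at hx
      rw [hx]; simp [wt]; ring
  · intro x _ _ h
    have := congrFun h i
    simp at this
  · intro x _; simp
  · intro x _; simp

theorem Ei_mul_ind (p : ℝ) (i : ι) (F H : (ι → Bool) → ℝ) (h : Ind i H) (x : ι → Bool) :
    Ei p i (fun x => F x * H x) x = Ei p i F x * H x := by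
  unfold Ei; beta_reduce; rw [h, h]; ring

theorem Ex_chi_mul (p : ℝ) (i : ι) (H : (ι → Bool) → ℝ) (h : Ind i H) :
    Ex p (fun x => chi p (x i) * H x) = 0 := by
  rw [← Ex_Ei p i]
  have : Ei p i (fun x => chi p (x i) * H x) = fun _ => 0 := by
    funext x
    rw [Ei_mul_ind p i (fun x => chi p (x i)) H h]
    simp [Ei, chi]; left; ring
  rw [this, Ex_const]

theorem Ex_chi_sq_mul {p : ℝ} (h0 : 0 < p) (h1 : p < 1) (i : ι) (H : (ι → Bool) → ℝ) (h : Ind i H) :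
    Ex p (fun x => chi p (x i) ^ 2 * H x) = Ex p H := by
  rw [← Ex_Ei p i]
  congr 1
  funext x
  rw [Ei_mul_ind p i (fun x => chi p (x i) ^ 2) H h]
  have hp : 0 < p * (1 - p) := mul_pos h0 (by linarith)
  have : Ei p i (fun x => chi p (x i) ^ 2) x = 1 := by
    simp [Ei, chi, div_pow, Real.sq_sqrt hp.le]
    have : 1 - p ≠ 0 := by linarith
    field_simp; ring
  rw [this, one_mul]

theorem Ei_ind (p : ℝ) (i : ι) (F : (ι → Bool) → ℝ) : Ind i (Ei p i F) := by
  intro x b; simp [Ei]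

theorem Ei_ind' (p : ℝ) (i j : ι) (F : (ι → Bool) → ℝ) (h : Ind j F) : Ind j (Ei p i F) := by
  by_cases hij : i = j
  · subst hij; exact Ei_ind _ _ _
  · intro x b
    unfold Ei
    rw [Function.update_comm (Ne.symm hij), h, Function.update_comm (Ne.symm hij), h]

theorem Ei_sub (p : ℝ) (i : ι) (F H : (ι → Bool) → ℝ) (x) :
    Ei p i (fun x => F x - H x) x = Ei p i F x - Ei p i H x := by
  unfold Ei; ring

theorem Ei_sq {p : ℝ} (h0 : 0 ≤ p) (h1 : p ≤ 1) (i : ι) (F : (ι → Bool) → ℝ) (x) :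
    (Ei p i F x) ^ 2 ≤ Ei p i (fun x => F x ^ 2) x := by
  unfold Ei
  have := mul_nonneg (mul_nonneg h0 (sub_nonneg.2 h1))
    (sq_nonneg (F (Function.update x i true) - F (Function.update x i false)))
  nlinarith

theorem ind_all_const (F : (ι → Bool) → ℝ) (h : ∀ i, Ind i F) (x y) : F x = F y := by
  have : ∀ s : Finset ι, F (fun i => if i ∈ s then x i else y i) = F y := by
    intro s
    induction s using Finset.induction_on with
    | empty => simp
    | insert a s ha ih =>
      rw [← ih, ← h a (fun i => if i ∈ s then x i else y i) (x a)]
      congr 1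
      funext j
      by_cases hj : j = a
      · subst hj; simp
      · simp [hj]
  simpa using this Finset.univ

theorem efron_aux {p : ℝ} (h0 : 0 ≤ p) (h1 : p ≤ 1) (F : (ι → Bool) → ℝ) (S : Finset ι) :
    ∃ A : (ι → Bool) → ℝ, (∀ i ∈ S, Ind i A) ∧ Ex p A = Ex p F ∧
      Ex p (fun x => (F x - A x) ^ 2) ≤ ∑ i ∈ S, Ex p (fun x => (F x - Ei p i F x) ^ 2) := by
  induction S using Finset.induction_on with
  | empty => exact ⟨F, by simp, rfl, by simp [Ex_const]⟩
  | insert a s ha ih =>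
    obtain ⟨A, hA, hE, hV⟩ := ih
    refine ⟨Ei p a A, ?_, by rw [Ex_Ei, hE], ?_⟩
    · intro i hi
      rcases Finset.mem_insert.1 hi with rfl | hi
      · exact Ei_ind _ _ _
      · exact Ei_ind' _ _ _ _ (hA i hi)
    · rw [Finset.sum_insert ha]
      have e : (fun x => (F x - Ei p a A x) ^ 2) = fun x => ((F x - Ei p a F x) ^ 2 +
          (Ei p a (fun x => F x - A x) x) ^ 2) +
          2 * ((F x - Ei p a F x) * Ei p a (fun x => F x - A x) x) := by
        funext x; rw [Ei_sub]; ring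
      have ez : Ex p (fun x => (F x - Ei p a F x) * Ei p a (fun x => F x - A x) x) = 0 := by
        rw [← Ex_Ei p a]
        have : Ei p a (fun x => (F x - Ei p a F x) * Ei p a (fun x => F x - A x) x) = fun _ => 0 := by
          funext x
          rw [Ei_mul_ind p a (fun x => (F x - Ei p a F x)) _ (Ei_ind _ _ _)]
          rw [Ei_sub]
          have : Ei p a (Ei p a F) x = Ei p a F x := by
            have := Ei_ind p a F
            unfold Ei at this ⊢
            simp only [Function.update_idem]; ring
          rw [this]; ring
        rw [this, Ex_const]
      rw [e, Ex_add, Ex_add, Ex_mul, ez]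
      have : Ex p (fun x => (Ei p a (fun x => F x - A x) x) ^ 2) ≤ Ex p (fun x => (F x - A x) ^ 2) := by
        rw [← Ex_Ei p a (fun x => (F x - A x) ^ 2)]
        exact Ex_mono h0 h1 fun x => Ei_sq h0 h1 _ _ _
      linarith

/-- Efron-Stein. -/
theorem efron {p : ℝ} (h0 : 0 ≤ p) (h1 : p ≤ 1) (F : (ι → Bool) → ℝ) :
    Ex p (fun x => (F x - Ex p F) ^ 2) ≤ ∑ i, Ex p (fun x => (F x - Ei p i F x) ^ 2) := by
  obtain ⟨A, hA, hE, hV⟩ := efron_aux h0 h1 F Finset.univ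
  have : ∀ x, A x = Ex p F := by
    intro x
    have : A = fun _ => A x := by
      funext y; exact ind_all_const A (fun i => hA i (Finset.mem_univ i)) y x
    rw [← hE]; conv_rhs => rw [this]
    rw [Ex_const]
  simpa [this] using hV

theorem sub_Ei_abs {p : ℝ} (h0 : 0 ≤ p) (h1 : p ≤ 1) (i : ι) (F : (ι → Bool) → ℝ) (x) (B : ℝ)
    (h : ∀ b, |F x - F (Function.update x i b)| ≤ B) : |F x - Ei p i F x| ≤ B := by
  have e : F x - Ei p i F x = p * (F x - F (Function.update x i true)) +
    (1 - p) * (F x - F (Function.update x i false)) := by unfold Ei; ring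
  have h2 := abs_le.1 (h true)
  have h3 := abs_le.1 (h false)
  rw [e, abs_le]
  constructor <;> nlinarith

end
end GSW

open MeasureTheory ProbabilityTheory
open scoped ENNReal NNReal
set_option linter.unusedSectionVars false
set_option linter.unusedVariables false
namespace GSW
noncomputable section

variable {ι : Type*} [Fintype ι] [DecidableEq ι]

def mon (p : ℝ) (S : Finset ι) (x : ι → Bool) : ℝ := ∏ e ∈ S, chi p (x e)

def Wp (p : ℝ) (c : Finset ι → ℝ) (x : ι → Bool) : ℝ := ∑ S : Finset ι, c S * mon p S x

def Pp (p : ℝ) (c : Finset ι → ℝ) (i : ι) (x : ι → Bool) : ℝ :=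
  ∑ S : Finset ι with i ∈ S, c S * mon p (S.erase i) x

def Rp (p : ℝ) (c : Finset ι → ℝ) (i : ι) (x : ι → Bool) : ℝ :=
  ∑ S : Finset ι with i ∉ S, c S * mon p S x

theorem mon_erase (p : ℝ) {S : Finset ι} {i : ι} (h : i ∈ S) (x) :
    mon p S x = chi p (x i) * mon p (S.erase i) x := by
  unfold mon; rw [Finset.mul_prod_erase _ (fun e => chi p (x e)) h]

theorem mon_ind (p : ℝ) {S : Finset ι} {i : ι} (h : i ∉ S) : Ind i (mon p S) := by
  intro x b
  unfold mon
  refine Finset.prod_congr rfl fun j hj => ?_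
  rw [Function.update_of_ne (by rintro rfl; exact h hj)]

theorem Ind.mul {i : ι} {F H : (ι → Bool) → ℝ} (hF : Ind i F) (hH : Ind i H) :
    Ind i (fun x => F x * H x) := by
  intro x b; simp only [hF x b, hH x b]

theorem Ind.comp {i : ι} {F : (ι → Bool) → ℝ} (hF : Ind i F) (g : ℝ → ℝ) :
    Ind i (fun x => g (F x)) := by
  intro x b; simp only [hF x b]

theorem Ind.sum {κ : Type*} {i : ι} {s : Finset κ} {F : κ → (ι → Bool) → ℝ}
    (hF : ∀ k ∈ s, Ind i (F k)) :
    Ind i (fun x => ∑ k ∈ s, F k x) := by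
  intro x b; exact Finset.sum_congr rfl fun k hk => hF k hk x b

theorem Ind.const {i : ι} (a : ℝ) : Ind i (fun _ => a) := fun _ _ => rfl

theorem Pp_ind (p : ℝ) (c : Finset ι → ℝ) (i : ι) : Ind i (Pp p c i) :=
  Ind.sum fun S _ => (Ind.const (c S)).mul (mon_ind p (Finset.notMem_erase i S))

theorem Rp_ind (p : ℝ) (c : Finset ι → ℝ) (i : ι) : Ind i (Rp p c i) :=
  Ind.sum fun S hS => (Ind.const (c S)).mul (mon_ind p (by simpa using hS))

theorem Wp_split (p : ℝ) (c : Finset ι → ℝ) (i : ι) (x) :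
    Wp p c x = chi p (x i) * Pp p c i x + Rp p c i x := by
  unfold Wp Pp Rp
  rw [← Finset.sum_filter_add_sum_filter_not Finset.univ (fun S : Finset ι => i ∈ S)]
  congr 1
  rw [Finset.mul_sum]
  refine Finset.sum_congr rfl fun S hS => ?_
  rw [mon_erase p (by simpa using hS)]; ring

theorem Wp_sum (p : ℝ) (c : Finset ι → ℝ) (h2 : ∀ S, c S ≠ 0 → 2 ≤ S.card) (x) :
    Wp p c x = ∑ i, chi p (x i) * Pp p (fun S => c S / S.card) i x := by
  unfold Wp Pp
  simp_rw [Finset.mul_sum, Finset.sum_filter]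
  rw [Finset.sum_comm]
  refine Finset.sum_congr rfl fun S _ => ?_
  rw [← Finset.sum_filter]
  have : ∀ i ∈ Finset.univ.filter (fun i => i ∈ S),
      chi p (x i) * (c S / S.card * mon p (S.erase i) x) = c S / S.card * mon p S x := by
    intro i hi
    rw [mon_erase p (by simpa using hi : i ∈ S)]; ring
  rw [Finset.sum_congr rfl this, Finset.sum_const]
  simp only [Finset.filter_mem_eq_inter, Finset.univ_inter, nsmul_eq_mul]
  by_cases hc : c S = 0
  · simp [hc]
  · have := h2 S hc
    have : (S.card : ℝ) ≠ 0 := by positivity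
    field_simp

theorem Ex_mon {p : ℝ} {S : Finset ι} (h : S.Nonempty) : Ex p (mon p S) = 0 := by
  obtain ⟨i, hi⟩ := h
  have : mon p S = fun x => chi p (x i) * mon p (S.erase i) x := by
    funext x; exact mon_erase p hi x
  rw [this]
  exact Ex_chi_mul p i _ (mon_ind p (Finset.notMem_erase i S))

theorem Ex_mon_sq {p : ℝ} (h0 : 0 < p) (h1 : p < 1) (S : Finset ι) :
    Ex p (fun x => mon p S x * mon p S x) = 1 := by
  induction S using Finset.induction_on with
  | empty => simp [mon, Ex_const]
  | insert a s ha ih =>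
    rw [← ih, ← Ex_chi_sq_mul h0 h1 a _ ((mon_ind p ha).mul (mon_ind p ha))]
    congr 1; funext x
    simp only [mon, Finset.prod_insert ha]; ring

theorem Ex_mon_mon {p : ℝ} {S S' : Finset ι} (h : S ≠ S') :
    Ex p (fun x => mon p S x * mon p S' x) = 0 := by
  have key : ∀ S S' : Finset ι, ∀ i, i ∈ S → i ∉ S' →
      Ex p (fun x => mon p S x * mon p S' x) = 0 := by
    intro S S' i hi hi'
    have : (fun x => mon p S x * mon p S' x) =
        fun x => chi p (x i) * (mon p (S.erase i) x * mon p S' x) := by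
      funext x; rw [mon_erase p hi x]; ring
    rw [this]
    exact Ex_chi_mul p i _ ((mon_ind p (Finset.notMem_erase i S)).mul (mon_ind p hi'))
  by_cases hs : S ⊆ S'
  · obtain ⟨i, hi, hi'⟩ := Finset.exists_of_ssubset (hs.ssubset_of_ne h)
    rw [← key S' S i hi hi']
    congr 1; funext x; ring
  · obtain ⟨i, hi, hi'⟩ := Finset.not_subset.1 hs
    exact key S S' i hi hi'

theorem Ex_Wp_sq {p : ℝ} (h0 : 0 < p) (h1 : p < 1) (c : Finset ι → ℝ) :
    Ex p (fun x => Wp p c x ^ 2) = ∑ S, c S ^ 2 := by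
  have : (fun x => Wp p c x ^ 2) = fun x => ∑ S, ∑ S', (c S * c S') * (mon p S x * mon p S' x) := by
    funext x; unfold Wp
    rw [sq, Finset.sum_mul_sum]
    exact Finset.sum_congr rfl fun S _ => Finset.sum_congr rfl fun S' _ => by ring
  rw [this, Ex_sum]
  refine Finset.sum_congr rfl fun S _ => ?_
  rw [Ex_sum, Finset.sum_eq_single S]
  · rw [Ex_mul p _ (fun x => mon p S x * mon p S x), Ex_mon_sq h0 h1]; ring
  · intro S' _ hS
    rw [Ex_mul p _ (fun x => mon p S x * mon p S' x), Ex_mon_mon hS.symm]; ring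
  · simp

theorem Ex_Wp (p : ℝ) (c : Finset ι → ℝ) (h2 : ∀ S, c S ≠ 0 → 2 ≤ S.card) :
    Ex p (Wp p c) = 0 := by
  have : Wp p c = fun x => ∑ S, c S * mon p S x := rfl
  rw [this, Ex_sum]
  refine Finset.sum_eq_zero fun S _ => ?_
  rw [Ex_mul p _ (mon p S)]
  by_cases hc : c S = 0
  · simp [hc]
  · rw [Ex_mon (Finset.card_pos.1 (by have := h2 S hc; omega)), mul_zero]

theorem Ex_Pp (p : ℝ) (c : Finset ι → ℝ) (h2 : ∀ S, c S ≠ 0 → 2 ≤ S.card) (i : ι) :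
    Ex p (Pp p c i) = 0 := by
  have : Pp p c i = fun x => ∑ S : Finset ι with i ∈ S, c S * mon p (S.erase i) x := rfl
  rw [this, Ex_sum]
  refine Finset.sum_eq_zero fun S hS => ?_
  rw [Ex_mul p _ (mon p (S.erase i))]
  by_cases hc : c S = 0
  · simp [hc]
  · rw [Ex_mon (Finset.card_pos.1 ?_), mul_zero]
    rw [Finset.card_erase_of_mem (by simpa using hS)]
    have := h2 S hc; omega

structure Good (p K n : ℝ) (c : Finset ι → ℝ) (N : ι → Finset ι) : Prop where
  hK : 1 ≤ K
  hn : 1 ≤ n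
  term : ∀ S, ∀ i ∈ S, ∀ x, |c S * mon p (S.erase i) x| ≤ K
  co : ∀ i g, i ≠ g → ((Finset.univ.filter fun S => i ∈ S ∧ g ∈ S ∧ c S ≠ 0).card : ℝ) ≤ K
  nb : ∀ S, c S ≠ 0 → ∀ i ∈ S, ∀ g ∈ S, i ≠ g → g ∈ N i
  symm : ∀ i g, g ∈ N i → i ∈ N g
  card : ∀ i, ((N i).card : ℝ) ≤ K * n
  two : ∀ S, c S ≠ 0 → 2 ≤ S.card

theorem Good.div {p K n : ℝ} {c : Finset ι → ℝ} {N : ι → Finset ι} (h : Good p K n c N) :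
    Good p K n (fun S => c S / S.card) N := by
  have hne : ∀ S : Finset ι, c S / S.card ≠ 0 → c S ≠ 0 := by
    intro S hS h0; simp [h0] at hS
  refine ⟨h.hK, h.hn, ?_, ?_, fun S hS => h.nb S (hne S hS), h.symm, h.card,
    fun S hS => h.two S (hne S hS)⟩
  · intro S i hi x
    have h1 := h.term S i hi x
    have h2 : (1 : ℝ) ≤ S.card := by exact_mod_cast Finset.card_pos.2 ⟨i, hi⟩
    have : c S / S.card * mon p (S.erase i) x = (c S * mon p (S.erase i) x) / S.card := by ring
    rw [this, abs_div, abs_of_pos (by linarith : (0 : ℝ) < S.card)]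
    exact (div_le_self (abs_nonneg _) h2).trans h1
  · intro i g hig
    refine le_trans ?_ (h.co i g hig)
    have : (Finset.univ.filter fun S => i ∈ S ∧ g ∈ S ∧ c S / S.card ≠ 0) ⊆
        (Finset.univ.filter fun S => i ∈ S ∧ g ∈ S ∧ c S ≠ 0) := by
      intro S
      simp only [Finset.mem_filter, Finset.mem_univ, true_and]
      rintro ⟨a, b, d⟩
      exact ⟨a, b, hne S d⟩
    exact_mod_cast Finset.card_le_card this

section
variable {p K n : ℝ} {c : Finset ι → ℝ} {N : ι → Finset ι}

theorem Good.osc (h : Good p K n c N) (i g : ι) (x b) :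
    |Pp p c i x - Pp p c i (Function.update x g b)| ≤ 2 * K ^ 2 := by
  have hK := h.hK
  by_cases hig : i = g
  · subst hig
    rw [Pp_ind p c i]; simp; positivity
  unfold Pp
  rw [← Finset.sum_sub_distrib]
  have e : ∑ S : Finset ι with i ∈ S, (c S * mon p (S.erase i) x -
      c S * mon p (S.erase i) (Function.update x g b)) =
      ∑ S : Finset ι with (i ∈ S ∧ g ∈ S ∧ c S ≠ 0), (c S * mon p (S.erase i) x -
      c S * mon p (S.erase i) (Function.update x g b)) := by
    symm
    refine Finset.sum_subset ?_ ?_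
    · intro S; simp; tauto
    · intro S hS hS'
      simp only [Finset.mem_filter, Finset.mem_univ, true_and] at hS hS'
      by_cases hc : c S = 0
      · simp [hc]
      · have : g ∉ S := by tauto
        rw [mon_ind p (fun hg => this (Finset.mem_of_mem_erase hg))]; ring
  rw [e]
  refine (Finset.abs_sum_le_sum_abs _ _).trans ?_
  have : ∀ S ∈ Finset.univ.filter (fun S : Finset ι => i ∈ S ∧ g ∈ S ∧ c S ≠ 0),
      |c S * mon p (S.erase i) x - c S * mon p (S.erase i) (Function.update x g b)| ≤ 2 * K := by
    intro S hS
    simp only [Finset.mem_filter, Finset.mem_univ, true_and] at hS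
    refine (abs_sub _ _).trans ?_
    have := h.term S i hS.1 x
    have := h.term S i hS.1 (Function.update x g b)
    linarith
  refine (Finset.sum_le_card_nsmul _ _ _ this).trans ?_
  rw [nsmul_eq_mul]
  have := h.co i g hig
  nlinarith

theorem Good.osc0 (h : Good p K n c N) (i g : ι) (hg : g ∉ N i) : Ind g (Pp p c i) := by
  by_cases hig : i = g
  · subst hig; exact Pp_ind p c i
  refine Ind.sum fun S hS => ?_
  by_cases hc : c S = 0
  · simp only [hc]; intro x b; simp
  · refine (Ind.const (c S)).mul (mon_ind p fun hg' => hg ?_)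
    exact h.nb S hc i (by simpa using hS) g (Finset.mem_of_mem_erase hg') hig

theorem Good.sq (h : Good p K n c N) (h0 : 0 ≤ p) (h1 : p ≤ 1) (i : ι) :
    Ex p (fun x => Pp p c i x ^ 2) ≤ K * n * (2 * K ^ 2) ^ 2 := by
  have := efron h0 h1 (Pp p c i)
  rw [Ex_Pp p c h.two] at this
  simp only [sub_zero] at this
  refine this.trans ?_
  have e : ∑ g, Ex p (fun x => (Pp p c i x - Ei p g (Pp p c i) x) ^ 2) =
      ∑ g ∈ N i, Ex p (fun x => (Pp p c i x - Ei p g (Pp p c i) x) ^ 2) := by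
    symm
    refine Finset.sum_subset (Finset.subset_univ _) fun g _ hg => ?_
    have : ∀ x, Pp p c i x - Ei p g (Pp p c i) x = 0 := by
      intro x; unfold Ei; rw [h.osc0 i g hg, h.osc0 i g hg]; ring
    simp [this, Ex_const]
  rw [e]
  have : ∀ g ∈ N i, Ex p (fun x => (Pp p c i x - Ei p g (Pp p c i) x) ^ 2) ≤ (2 * K ^ 2) ^ 2 := by
    intro g _
    refine (Ex_mono h0 h1 (H := fun _ => (2 * K ^ 2) ^ 2) fun x => ?_).trans (Ex_const p _).le
    exact sq_le_sq' (abs_le.1 (sub_Ei_abs h0 h1 g _ x _ fun b => h.osc i g x b)).1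
      (abs_le.1 (sub_Ei_abs h0 h1 g _ x _ fun b => h.osc i g x b)).2
  refine (Finset.sum_le_card_nsmul _ _ _ this).trans ?_
  rw [nsmul_eq_mul]
  exact mul_le_mul_of_nonneg_right (h.card i) (by positivity)

theorem Good.abs (h : Good p K n c N) (i : ι) (x) : |Pp p c i x| ≤ K ^ 3 * n := by
  have hK := h.hK
  have hn := h.hn
  have e : Pp p c i x = ∑ S : Finset ι with (i ∈ S ∧ c S ≠ 0), c S * mon p (S.erase i) x := by
    unfold Pp
    symm
    refine Finset.sum_subset ?_ ?_
    · intro S; simp; tauto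
    · intro S hS hS'
      simp only [Finset.mem_filter, Finset.mem_univ, true_and] at hS hS'
      have : c S = 0 := by tauto
      simp [this]
  rw [e]
  refine (Finset.abs_sum_le_sum_abs _ _).trans ?_
  refine (Finset.sum_le_card_nsmul _ _ K ?_).trans ?_
  · intro S hS
    simp only [Finset.mem_filter, Finset.mem_univ, true_and] at hS
    exact h.term S i hS.1 x
  rw [nsmul_eq_mul]
  have hsub : (Finset.univ.filter fun S : Finset ι => i ∈ S ∧ c S ≠ 0) ⊆
      ((N i).erase i).biUnion fun g => Finset.univ.filter fun S => i ∈ S ∧ g ∈ S ∧ c S ≠ 0 := by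
    intro S hS
    simp only [Finset.mem_filter, Finset.mem_univ, true_and] at hS
    obtain ⟨g, hg, hgi⟩ := Finset.exists_mem_ne (h.two S hS.2) i
    simp only [Finset.mem_biUnion, Finset.mem_filter, Finset.mem_univ, true_and]
    exact ⟨g, Finset.mem_erase.2 ⟨hgi, h.nb S hS.2 i hS.1 g hg hgi.symm⟩, hS.1, hg, hS.2⟩
  have hc : ((Finset.univ.filter fun S : Finset ι => i ∈ S ∧ c S ≠ 0).card : ℝ) ≤ K * n * K := by
    have h1 : ((Finset.univ.filter fun S : Finset ι => i ∈ S ∧ c S ≠ 0).card : ℝ) ≤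
        ∑ g ∈ (N i).erase i, ((Finset.univ.filter fun S => i ∈ S ∧ g ∈ S ∧ c S ≠ 0).card : ℝ) := by
      exact_mod_cast (Finset.card_le_card hsub).trans Finset.card_biUnion_le
    refine h1.trans ((Finset.sum_le_card_nsmul _ _ K ?_).trans ?_)
    · intro g hg
      exact h.co i g (Finset.ne_of_mem_erase hg).symm
    · rw [nsmul_eq_mul]
      have : (((N i).erase i).card : ℝ) ≤ K * n := by
        refine le_trans ?_ (h.card i)
        exact_mod_cast Finset.card_le_card (Finset.erase_subset _ _)
      nlinarith
  nlinarith

def Tp (p : ℝ) (c : Finset ι → ℝ) (x : ι → Bool) : ℝ :=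
  ∑ i, Pp p (fun S => c S / S.card) i x * Pp p c i x

theorem Good.varT (h : Good p K n c N) (h0 : 0 ≤ p) (h1 : p ≤ 1)
    (hι : (Fintype.card ι : ℝ) ≤ K * n ^ 2) :
    Ex p (fun x => (Tp p c x - Ex p (Tp p c)) ^ 2) ≤ 144 * K ^ 12 * n ^ 5 := by
  have hK := h.hK
  have hn := h.hn
  have h' := h.div
  set G := Pp p (fun S => c S / S.card) with hG
  set D := Pp p c with hD
  set B := 2 * K ^ 2 with hB
  have hB0 : 0 ≤ B := by positivity
  refine (efron h0 h1 (Tp p c)).trans ?_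
  have key : ∀ g x, |Tp p c x - Ei p g (Tp p c) x| ≤ ∑ i ∈ N g, B * (|G i x| + |D i x| + B) := by
    intro g x
    refine sub_Ei_abs h0 h1 g _ x _ fun b => ?_
    have e : Tp p c x - Tp p c (Function.update x g b) =
        ∑ i ∈ N g, (G i x * D i x - G i (Function.update x g b) * D i (Function.update x g b)) := by
      unfold Tp
      rw [← Finset.sum_sub_distrib]
      symm
      refine Finset.sum_subset (Finset.subset_univ _) fun i _ hi => ?_
      have hgi : g ∉ N i := fun hh => hi (h.symm i g hh)
      have a1 : G i (Function.update x g b) = G i x := h'.osc0 i g hgi x b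
      have a2 : D i (Function.update x g b) = D i x := h.osc0 i g hgi x b
      rw [a1, a2, sub_self]
    rw [e]
    refine (Finset.abs_sum_le_sum_abs _ _).trans (Finset.sum_le_sum fun i _ => ?_)
    have o1 := h'.osc i g x b
    have o2 := h.osc i g x b
    rw [← hG] at o1
    rw [← hD] at o2
    have e2 : G i x * D i x - G i (Function.update x g b) * D i (Function.update x g b) =
        G i x * (D i x - D i (Function.update x g b)) + D i x * (G i x - G i (Function.update x g b))
        - (D i x - D i (Function.update x g b)) * (G i x - G i (Function.update x g b)) := by ring
    rw [e2]
    refine (abs_sub _ _).trans ((add_le_add_left (abs_add_le _ _) _).trans ?_)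
    rw [abs_mul, abs_mul, abs_mul]
    have := mul_le_mul_of_nonneg_left o2 (abs_nonneg (G i x))
    have := mul_le_mul_of_nonneg_left o1 (abs_nonneg (D i x))
    have := mul_le_mul o2 o1 (abs_nonneg _) hB0
    linarith
  have key2 : ∀ g, Ex p (fun x => (Tp p c x - Ei p g (Tp p c) x) ^ 2) ≤ 9 * K ^ 3 * B ^ 4 * n ^ 3 := by
    intro g
    have hx : ∀ x, (Tp p c x - Ei p g (Tp p c) x) ^ 2 ≤
        ((N g).card : ℝ) * ∑ i ∈ N g, (3 * B ^ 2) * (G i x ^ 2 + D i x ^ 2 + B ^ 2) := by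
      intro x
      rw [← sq_abs]
      refine (pow_le_pow_left₀ (abs_nonneg _) (key g x) 2).trans ?_
      refine sq_sum_le_card_mul_sum_sq.trans ?_
      refine mul_le_mul_of_nonneg_left (Finset.sum_le_sum fun i _ => ?_) (by positivity)
      have : (|G i x| + |D i x| + B) ^ 2 ≤ 3 * (G i x ^ 2 + D i x ^ 2 + B ^ 2) := by
        rw [← sq_abs (G i x), ← sq_abs (D i x)]
        nlinarith [sq_nonneg (|G i x| - |D i x|), sq_nonneg (|G i x| - B), sq_nonneg (B - |D i x|)]
      rw [mul_pow]
      nlinarith [sq_nonneg B]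
    refine (Ex_mono h0 h1 hx).trans ?_
    rw [Ex_mul, Ex_sum]
    have hi : ∀ i ∈ N g, Ex p (fun x => (3 * B ^ 2) * (G i x ^ 2 + D i x ^ 2 + B ^ 2)) ≤
        (3 * B ^ 2) * (3 * (K * n * B ^ 2)) := by
      intro i _
      rw [Ex_mul p (3 * B ^ 2), Ex_add, Ex_add, Ex_const]
      have s1 := h'.sq h0 h1 i
      have s2 := h.sq h0 h1 i
      rw [← hG, ← hB] at s1
      rw [← hD, ← hB] at s2
      have : B ^ 2 ≤ K * n * B ^ 2 := by
        have : 1 ≤ K * n := by nlinarith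
        nlinarith [sq_nonneg B]
      refine mul_le_mul_of_nonneg_left ?_ (by positivity)
      linarith
    have hs := Finset.sum_le_card_nsmul _ _ _ hi
    rw [nsmul_eq_mul] at hs
    have hc := h.card g
    calc ((N g).card : ℝ) * ∑ i ∈ N g, Ex p (fun x => (3 * B ^ 2) * (G i x ^ 2 + D i x ^ 2 + B ^ 2))
        ≤ ((N g).card : ℝ) * (((N g).card : ℝ) * ((3 * B ^ 2) * (3 * (K * n * B ^ 2)))) := by gcongr
      _ ≤ (K * n) * ((K * n) * ((3 * B ^ 2) * (3 * (K * n * B ^ 2)))) := by gcongr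
      _ = _ := by ring
  refine (Finset.sum_le_card_nsmul _ _ _ fun g _ => key2 g).trans ?_
  rw [nsmul_eq_mul, Finset.card_univ]
  calc (Fintype.card ι : ℝ) * (9 * K ^ 3 * B ^ 4 * n ^ 3)
      ≤ (K * n ^ 2) * (9 * K ^ 3 * B ^ 4 * n ^ 3) := by gcongr
    _ = _ := by rw [hB]; ring

theorem Good.ET (h : Good p K n c N) (h0 : 0 < p) (h1 : p < 1) :
    Ex p (Tp p c) = Ex p (fun x => Wp p c x ^ 2) := by
  have e : (fun x => Wp p c x ^ 2) = fun x => ∑ i,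
      (chi p (x i) ^ 2 * (Pp p (fun S => c S / S.card) i x * Pp p c i x) +
       chi p (x i) * (Pp p (fun S => c S / S.card) i x * Rp p c i x)) := by
    funext x
    rw [_root_.sq]; nth_rw 1 [Wp_sum p c h.two x]
    rw [Finset.sum_mul]
    refine Finset.sum_congr rfl fun i _ => ?_
    rw [Wp_split p c i x]; ring
  have e2 : Tp p c = fun x => ∑ i, Pp p (fun S => c S / S.card) i x * Pp p c i x := rfl
  rw [e, e2, Ex_sum, Ex_sum]
  refine Finset.sum_congr rfl fun i _ => ?_
  rw [Ex_add, Ex_chi_sq_mul h0 h1 i _ ((Pp_ind p _ i).mul (Pp_ind p _ i)),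
    Ex_chi_mul p i _ ((Pp_ind p _ i).mul (Rp_ind p _ i)), add_zero]

end
end
end GSW

open MeasureTheory ProbabilityTheory
open scoped ENNReal NNReal
set_option linter.unusedSectionVars false
set_option linter.unusedVariables false
namespace GSW
noncomputable section

variable {ι : Type*} [Fintype ι] [DecidableEq ι]
variable {p K n : ℝ} {c : Finset ι → ℝ} {N : ι → Finset ι}

theorem taylor {F F' : ℝ → ℝ} {A : ℝ} (hF : ∀ w, HasDerivAt F (F' w) w)
    (hL : ∀ u v, |F' u - F' v| ≤ A * |u - v|) (a d : ℝ) :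
    |F (a + d) - F a - F' a * d| ≤ A * d ^ 2 := by
  have hA : 0 ≤ A := by
    have := hL 1 0
    have h2 := abs_nonneg (F' 1 - F' 0)
    simp at this; linarith
  let H : ℝ → ℝ := fun t => F t - F' a * t
  have hd : ∀ t, HasDerivAt H (F' t - F' a) t := by
    intro t
    exact ((hF t).sub ((hasDerivAt_id t).const_mul (F' a))).congr_deriv (by simp)
  have hb : ∀ t ∈ Set.uIcc a (a + d), ‖F' t - F' a‖ ≤ A * |d| := by
    intro t ht
    rw [Real.norm_eq_abs]
    refine (hL t a).trans (mul_le_mul_of_nonneg_left ?_ hA)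
    have := Set.abs_sub_left_of_mem_uIcc ht
    simpa using this
  have := (convex_uIcc a (a + d)).norm_image_sub_le_of_norm_hasDerivWithin_le
    (fun t _ => (hd t).hasDerivWithinAt) hb Set.left_mem_uIcc Set.right_mem_uIcc
  simp only [Real.norm_eq_abs, H] at this
  have e : F (a + d) - F a - F' a * d = F (a + d) - F' a * (a + d) - (F a - F' a * a) := by ring
  rw [e]
  refine this.trans (le_of_eq ?_)
  rw [add_sub_cancel_left, mul_assoc, ← sq, sq_abs]

theorem Good.step (h : Good p K n c N) (h0 : 0 < p) (h1 : p < 1) {M : ℝ} (hM : 1 ≤ M)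
    (hchi : ∀ b, |chi p b| ≤ M) {s : ℝ} (hs : 0 < s)
    {F F' : ℝ → ℝ} {A : ℝ} (hF : ∀ w, HasDerivAt F (F' w) w)
    (hL : ∀ u v, |F' u - F' v| ≤ A * |u - v|) (i : ι) :
    |Ex p (fun x => chi p (x i) * Pp p (fun S => c S / S.card) i x * F (Wp p c x / s)) -
      Ex p (fun x => Pp p (fun S => c S / S.card) i x * Pp p c i x * F' (Wp p c x / s)) / s| ≤
      8 * A * M ^ 3 * K ^ 8 * n ^ 2 / s ^ 2 := by
  have hA : 0 ≤ A := by
    have := hL 1 0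
    have h2 := abs_nonneg (F' 1 - F' 0)
    simp at this; linarith
  have hK := h.hK
  have hn := h.hn
  set G := Pp p (fun S => c S / S.card) i with hG
  set D := Pp p c i with hD
  set R := Rp p c i with hR
  have z1 : Ex p (fun x => chi p (x i) * (G x * F (R x / s))) = 0 :=
    Ex_chi_mul p i _ ((Pp_ind p _ i).mul ((Rp_ind p _ i).comp fun t => F (t / s)))
  have z2 : Ex p (fun x => chi p (x i) ^ 2 * (G x * D x * F' (R x / s))) =
      Ex p (fun x => G x * D x * F' (R x / s)) :=
    Ex_chi_sq_mul h0 h1 i _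
      (((Pp_ind p _ i).mul (Pp_ind p _ i)).mul ((Rp_ind p _ i).comp fun t => F' (t / s)))
  have e : Ex p (fun x => chi p (x i) * G x * F (Wp p c x / s)) -
      Ex p (fun x => G x * D x * F' (Wp p c x / s)) / s =
      Ex p (fun x => (chi p (x i) * G x * F (Wp p c x / s) - chi p (x i) * (G x * F (R x / s))
        - s⁻¹ * (chi p (x i) ^ 2 * (G x * D x * F' (R x / s)))) +
        s⁻¹ * (G x * D x * F' (R x / s) - G x * D x * F' (Wp p c x / s))) := by
    rw [Ex_add, Ex_sub, Ex_sub, Ex_mul, Ex_mul, Ex_sub, z1, z2]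
    field_simp; ring
  rw [e]
  refine (Ex_abs h0.le h1.le _).trans ?_
  have hx : ∀ x, |(chi p (x i) * G x * F (Wp p c x / s) - chi p (x i) * (G x * F (R x / s))
        - s⁻¹ * (chi p (x i) ^ 2 * (G x * D x * F' (R x / s)))) +
        s⁻¹ * (G x * D x * F' (R x / s) - G x * D x * F' (Wp p c x / s))| ≤
        (2 * A * M ^ 3 * (K ^ 3 * n) / s ^ 2) * D x ^ 2 := by
    intro x
    set X := chi p (x i) with hX
    have hXM : |X| ≤ M := hchi _
    have hGx : |G x| ≤ K ^ 3 * n := h.div.abs i x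
    have hW : Wp p c x / s = R x / s + X * D x / s := by
      rw [Wp_split p c i x]; ring
    have t := taylor hF hL (R x / s) (X * D x / s)
    have l := hL (R x / s) (Wp p c x / s)
    rw [← hW] at t
    have l2 : |R x / s - Wp p c x / s| = |X| * |D x| / s := by
      rw [hW, sub_add_cancel_left, abs_neg, abs_div, abs_mul, abs_of_pos hs]
    rw [l2] at l
    have e1 : X * G x * F (Wp p c x / s) - X * (G x * F (R x / s))
        - s⁻¹ * (X ^ 2 * (G x * D x * F' (R x / s))) =
        X * G x * (F (Wp p c x / s) - F (R x / s) - F' (R x / s) * (X * D x / s)) := by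
      field_simp
    have e2 : s⁻¹ * (G x * D x * F' (R x / s) - G x * D x * F' (Wp p c x / s)) =
        s⁻¹ * (G x * D x * (F' (R x / s) - F' (Wp p c x / s))) := by ring
    rw [e1, e2]
    have hM0 : 0 ≤ M := by linarith
    have hM3 : M ≤ M ^ 3 := by
      calc M = M ^ 1 := (pow_one M).symm
        _ ≤ M ^ 3 := pow_le_pow_right₀ hM (by norm_num)
    have b1 : |X * G x * (F (Wp p c x / s) - F (R x / s) - F' (R x / s) * (X * D x / s))| ≤
        M * (K ^ 3 * n) * (A * (M ^ 2 * D x ^ 2 / s ^ 2)) := by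
      rw [abs_mul, abs_mul]
      have : A * (X * D x / s) ^ 2 ≤ A * (M ^ 2 * D x ^ 2 / s ^ 2) := by
        rw [div_pow, mul_pow]
        have : X ^ 2 ≤ M ^ 2 := by rw [← sq_abs]; gcongr
        gcongr
      gcongr
      exact t.trans this
    have b2 : |s⁻¹ * (G x * D x * (F' (R x / s) - F' (Wp p c x / s)))| ≤
        s⁻¹ * ((K ^ 3 * n) * |D x| * (A * (M * |D x| / s))) := by
      rw [abs_mul, abs_mul, abs_mul, abs_of_pos (inv_pos.2 hs)]
      have : A * (|X| * |D x| / s) ≤ A * (M * |D x| / s) := by gcongr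
      gcongr
      exact l.trans this
    refine (abs_add_le _ _).trans ((add_le_add b1 b2).trans ?_)
    have e3 : s⁻¹ * ((K ^ 3 * n) * |D x| * (A * (M * |D x| / s))) =
        (A * M * (K ^ 3 * n) / s ^ 2) * D x ^ 2 := by
      rw [← sq_abs (D x)]; field_simp
    have e4 : M * (K ^ 3 * n) * (A * (M ^ 2 * D x ^ 2 / s ^ 2)) =
        (A * M ^ 3 * (K ^ 3 * n) / s ^ 2) * D x ^ 2 := by ring
    rw [e3, e4, ← add_mul]
    refine mul_le_mul_of_nonneg_right ?_ (sq_nonneg _)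
    rw [← add_div]
    have : A * M * (K ^ 3 * n) ≤ A * M ^ 3 * (K ^ 3 * n) := by gcongr
    gcongr
    linarith
  refine (Ex_mono h0.le h1.le hx).trans ?_
  rw [Ex_mul]
  have := h.sq h0.le h1.le i
  calc _ ≤ (2 * A * M ^ 3 * (K ^ 3 * n) / s ^ 2) * (K * n * (2 * K ^ 2) ^ 2) := by gcongr
    _ = _ := by ring

theorem Good.stein (h : Good p K n c N) (h0 : 0 < p) (h1 : p < 1) {M : ℝ} (hM : 1 ≤ M)
    (hchi : ∀ b, |chi p b| ≤ M) {s : ℝ} (hs : 0 < s)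
    (hι : (Fintype.card ι : ℝ) ≤ K * n ^ 2)
    (hs2 : Ex p (fun x => Wp p c x ^ 2) = s ^ 2)
    {F F' : ℝ → ℝ} {A : ℝ} (hF : ∀ w, HasDerivAt F (F' w) w)
    (hA : ∀ w, |F' w| ≤ A)
    (hL : ∀ u v, |F' u - F' v| ≤ A * |u - v|) :
    |Ex p (fun x => F' (Wp p c x / s) - (Wp p c x / s) * F (Wp p c x / s))| ≤
      12 * A * K ^ 6 * Real.sqrt (n ^ 5) / s ^ 2 + 8 * A * M ^ 3 * K ^ 9 * n ^ 4 / s ^ 3 := by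
  have hA0 : 0 ≤ A := (abs_nonneg _).trans (hA 0)
  have hK := h.hK
  have hn := h.hn
  set Q : ι → ℝ := fun i => Ex p (fun x => chi p (x i) * Pp p (fun S => c S / S.card) i x * F (Wp p c x / s)) -
      Ex p (fun x => Pp p (fun S => c S / S.card) i x * Pp p c i x * F' (Wp p c x / s)) / s with hQ
  have e1 : Ex p (fun x => (Wp p c x / s) * F (Wp p c x / s)) =
      s⁻¹ * ∑ i, Ex p (fun x => chi p (x i) * Pp p (fun S => c S / S.card) i x * F (Wp p c x / s)) := by
    rw [← Ex_sum, ← Ex_mul]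
    congr 1; funext x
    rw [← Finset.sum_mul, ← Wp_sum p c h.two]; ring
  have e2 : Ex p (fun x => Tp p c x * F' (Wp p c x / s)) =
      ∑ i, Ex p (fun x => Pp p (fun S => c S / S.card) i x * Pp p c i x * F' (Wp p c x / s)) := by
    rw [← Ex_sum]
    congr 1; funext x
    rw [← Finset.sum_mul]; rfl
  have e3 : Ex p (fun x => F' (Wp p c x / s) - (Wp p c x / s) * F (Wp p c x / s)) =
      - ((s ^ 2)⁻¹ * Ex p (fun x => (Tp p c x - Ex p (Tp p c)) * F' (Wp p c x / s)))
        - s⁻¹ * ∑ i, Q i := by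
    have : (fun x => (Tp p c x - Ex p (Tp p c)) * F' (Wp p c x / s)) =
      fun x => Tp p c x * F' (Wp p c x / s) - s ^ 2 * F' (Wp p c x / s) := by
      funext x; rw [h.ET h0 h1, hs2]; ring
    rw [this, Ex_sub, Ex_sub, Ex_mul p (s ^ 2), e1, e2, hQ, Finset.sum_sub_distrib, ← Finset.sum_div]
    field_simp; ring
  rw [e3]
  have b1 : |Ex p (fun x => (Tp p c x - Ex p (Tp p c)) * F' (Wp p c x / s))| ≤
      A * (12 * K ^ 6 * Real.sqrt (n ^ 5)) := by
    refine (Ex_abs h0.le h1.le _).trans ?_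
    have : Ex p (fun x => |(Tp p c x - Ex p (Tp p c)) * F' (Wp p c x / s)|) ≤
        Ex p (fun x => A * |Tp p c x - Ex p (Tp p c)|) := by
      refine Ex_mono h0.le h1.le fun x => ?_
      rw [abs_mul, mul_comm]
      exact mul_le_mul_of_nonneg_right (hA _) (abs_nonneg _)
    refine this.trans ?_
    rw [Ex_mul]
    refine mul_le_mul_of_nonneg_left ?_ hA0
    have v := (Ex_sq_le h0.le h1.le (fun x => |Tp p c x - Ex p (Tp p c)|))
    simp only [sq_abs] at v
    have v2 := v.trans (h.varT h0.le h1.le hι)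
    refine abs_le_of_sq_le_sq' ?_ (by positivity) |>.2
    refine v2.trans (le_of_eq ?_)
    rw [mul_pow, Real.sq_sqrt (by positivity)]; ring
  have b2 : |∑ i, Q i| ≤ K * n ^ 2 * (8 * A * M ^ 3 * K ^ 8 * n ^ 2 / s ^ 2) := by
    refine (Finset.abs_sum_le_sum_abs _ _).trans ?_
    refine (Finset.sum_le_card_nsmul _ _ _ fun i _ => h.step h0 h1 hM hchi hs hF hL i).trans ?_
    rw [nsmul_eq_mul, Finset.card_univ]
    gcongr
  refine (abs_sub _ _).trans ?_
  rw [abs_neg, abs_mul, abs_mul, abs_of_pos (by positivity : 0 < (s ^ 2)⁻¹), abs_of_pos (inv_pos.2 hs)]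
  calc _ ≤ (s ^ 2)⁻¹ * (A * (12 * K ^ 6 * Real.sqrt (n ^ 5))) +
        s⁻¹ * (K * n ^ 2 * (8 * A * M ^ 3 * K ^ 8 * n ^ 2 / s ^ 2)) := by gcongr
    _ = _ := by field_simp
end
end GSW

open MeasureTheory ProbabilityTheory
open scoped ENNReal NNReal
set_option linter.unusedSectionVars false
set_option linter.unusedVariables false
namespace GSW
noncomputable section
open Filter Topology

def ph (t : ℝ) : ℝ := Real.exp (-(1 / 2) * t ^ 2)

theorem ph_pos (t : ℝ) : 0 < ph t := Real.exp_pos _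

theorem ph_cont : Continuous ph := by unfold ph; fun_prop

theorem ph_int : Integrable ph := integrable_exp_neg_mul_sq (by norm_num)

theorem tph_int : Integrable fun t => t * ph t := integrable_mul_exp_neg_mul_sq (by norm_num)

theorem ph_deriv (t : ℝ) : HasDerivAt ph (-t * ph t) t := by
  unfold ph
  have : HasDerivAt (fun t : ℝ => -(1 / 2) * t ^ 2) (-t) t :=
    ((hasDerivAt_pow 2 t).const_mul (-(1 / 2))).congr_deriv (by norm_num; ring)
  exact this.exp.congr_deriv (by ring)

theorem ph_tendsto : Tendsto ph atTop (𝓝 0) := by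
  unfold ph
  refine Real.tendsto_exp_atBot.comp ?_
  exact (tendsto_pow_atTop (by norm_num)).const_mul_atTop_of_neg (by norm_num)

theorem ph_total : ∫ t, ph t ≤ 3 := by
  unfold ph
  rw [integral_gaussian]
  rw [Real.sqrt_le_iff]
  constructor
  · norm_num
  · have := Real.pi_lt_d2
    linarith

theorem I1_eq (w : ℝ) : ∫ t in Set.Ioi w, t * ph t = ph w := by
  have := integral_Ioi_of_hasDerivAt_of_tendsto' (a := w) (f := fun t => - ph t)
    (f' := fun t => t * ph t) (m := 0)
    (fun t _ => (ph_deriv t).neg.congr_deriv (by ring)) tph_int.integrableOn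
    (by simpa using ph_tendsto.neg)
  simpa using this

theorem I0_ge (w : ℝ) : w / (1 + w ^ 2) * ph w ≤ ∫ t in Set.Ioi w, ph t := by
  have hpos : ∀ t : ℝ, 0 < 1 + t ^ 2 := fun t => by positivity
  have hle : ∀ t : ℝ, 2 / (1 + t ^ 2) ^ 2 ≤ 2 := by
    intro t
    rw [div_le_iff₀ (by have := hpos t; positivity)]
    nlinarith [sq_nonneg t, sq_nonneg (t ^ 2)]
  have hint : Integrable fun t => (1 - 2 / (1 + t ^ 2) ^ 2) * ph t := by
    refine ph_int.bdd_mul (c := 1) ?_ ?_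
    · refine Continuous.aestronglyMeasurable ?_
      refine continuous_const.sub (continuous_const.div (by fun_prop) fun t => ?_)
      have := hpos t; positivity
    · refine Eventually.of_forall fun t => ?_
      rw [Real.norm_eq_abs, abs_le]
      have := hpos t
      have h2 : 0 ≤ 2 / (1 + t ^ 2) ^ 2 := by positivity
      constructor <;> linarith [hle t]
  have := integral_Ioi_of_hasDerivAt_of_tendsto' (a := w) (f := fun t => - (t / (1 + t ^ 2) * ph t))
    (f' := fun t => (1 - 2 / (1 + t ^ 2) ^ 2) * ph t) (m := 0) ?_ hint.integrableOn ?_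
  · have h2 : ∫ t in Set.Ioi w, (1 - 2 / (1 + t ^ 2) ^ 2) * ph t ≤ ∫ t in Set.Ioi w, ph t := by
      refine integral_mono hint.integrableOn ph_int.integrableOn fun t => ?_
      have := ph_pos t
      have := hpos t
      have h2 : 0 ≤ 2 / (1 + t ^ 2) ^ 2 := by positivity
      show (1 - 2 / (1 + t ^ 2) ^ 2) * ph t ≤ ph t
      nlinarith
    rw [this] at h2
    linarith
  · intro t _
    have hd : HasDerivAt (fun t : ℝ => 1 + t ^ 2) (2 * t) t :=
      ((hasDerivAt_pow 2 t).const_add 1).congr_deriv (by norm_num)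
    refine ((((hasDerivAt_id t).div hd (hpos t).ne').mul (ph_deriv t)).neg).congr_deriv ?_
    have := (hpos t).ne'
    simp only [id, Pi.div_apply]
    field_simp
    ring
  · rw [← neg_zero]
    refine Tendsto.neg ?_
    refine squeeze_zero_norm (fun t => ?_) ph_tendsto
    rw [norm_mul, Real.norm_eq_abs, Real.norm_eq_abs, abs_of_pos (ph_pos t), abs_div,
      abs_of_pos (hpos t)]
    have : |t| / (1 + t ^ 2) ≤ 1 := by
      rw [div_le_one (hpos t), ← sq_abs]
      nlinarith [sq_nonneg (|t| - 1)]
    have := ph_pos t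
    nlinarith

theorem kph_int {k : ℝ → ℝ} (hk : ∀ s t, |k s - k t| ≤ |s - t|) : Integrable fun t => k t * ph t := by
  have hc : Continuous k := by
    have : LipschitzWith 1 k := LipschitzWith.of_dist_le_mul fun s t => by
      simpa [Real.dist_eq] using hk s t
    exact this.continuous
  refine ((tph_int.abs).add (ph_int.const_mul |k 0|)).mono' (by
    exact (hc.mul ph_cont).aestronglyMeasurable) (Eventually.of_forall fun t => ?_)
  have := ph_pos t
  have h1 := hk t 0
  have h2 := abs_sub_abs_le_abs_sub (k t) (k 0)
  simp only [Pi.add_apply]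
  rw [Real.norm_eq_abs, abs_mul, abs_mul, abs_of_pos this, ← add_mul]
  refine mul_le_mul_of_nonneg_right ?_ this.le
  simp at h1
  linarith

theorem half {k : ℝ → ℝ} (hk : ∀ s t, |k s - k t| ≤ |s - t|) (hk0 : ∀ w, |k w| ≤ |w| + 1)
    (w : ℝ) (hw : 0 ≤ w) :
    |(ph w)⁻¹ * ∫ t in Set.Ioi w, k t * ph t| ≤ 8 ∧
    |w * (k w - w * ((ph w)⁻¹ * ∫ t in Set.Ioi w, k t * ph t))| ≤ 3 ∧
    |k w - w * ((ph w)⁻¹ * ∫ t in Set.Ioi w, k t * ph t)| ≤ 10 := by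
  set J := ∫ t in Set.Ioi w, k t * ph t with hJ
  set I0 := ∫ t in Set.Ioi w, ph t with hI0
  have hp := ph_pos w
  have kint := kph_int hk
  have d1 : |J - k w * I0| ≤ ph w - w * I0 := by
    have e1 : J - k w * I0 = ∫ t in Set.Ioi w, (k t - k w) * ph t := by
      rw [hJ, hI0, ← integral_const_mul, ← integral_sub kint.integrableOn
        (ph_int.const_mul _).integrableOn]
      congr 1; funext t; ring
    have e2 : ph w - w * I0 = ∫ t in Set.Ioi w, (t - w) * ph t := by
      rw [← I1_eq w, hI0, ← integral_const_mul, ← integral_sub tph_int.integrableOn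
        (ph_int.const_mul _).integrableOn]
      congr 1; funext t; ring
    rw [e1, e2, ← Real.norm_eq_abs]
    refine norm_integral_le_of_norm_le ?_ ?_
    · have : Integrable fun t => (t - w) * ph t := by
        refine (tph_int.sub (ph_int.const_mul w)).congr (Eventually.of_forall fun t => ?_)
        simp only [Pi.sub_apply]; ring
      exact this.integrableOn
    · refine (ae_restrict_iff' measurableSet_Ioi).2 (Eventually.of_forall fun t ht => ?_)
      rw [norm_mul, Real.norm_eq_abs, Real.norm_eq_abs, abs_of_pos (ph_pos t)]
      refine mul_le_mul_of_nonneg_right ?_ (ph_pos t).le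
      have := hk t w
      rwa [abs_of_pos (sub_pos.2 (Set.mem_Ioi.1 ht))] at this
  have d2 := I0_ge w
  rw [← hI0] at d2
  have d3 : I0 ≤ 3 := by
    refine le_trans ?_ ph_total
    exact setIntegral_le_integral ph_int (Eventually.of_forall fun t => (ph_pos t).le)
  have d0 : 0 ≤ I0 := integral_nonneg fun t => (ph_pos t).le
  set m := (ph w)⁻¹ * I0 with hm
  set Q := (ph w)⁻¹ * J with hQ
  have m0 : 0 ≤ m := by positivity
  have hI : I0 = ph w * m := by rw [hm]; field_simp
  have hJQ : J = ph w * Q := by rw [hQ]; field_simp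
  have g1 : |Q - k w * m| ≤ 1 - w * m := by
    rw [hI, hJQ] at d1
    have : ph w * Q - k w * (ph w * m) = ph w * (Q - k w * m) := by ring
    rw [this, abs_mul, abs_of_pos hp] at d1
    have : ph w - w * (ph w * m) = ph w * (1 - w * m) := by ring
    rw [this] at d1
    exact le_of_mul_le_mul_left d1 hp
  have g2 : w / (1 + w ^ 2) ≤ m := by
    rw [hI] at d2
    refine le_of_mul_le_mul_left ?_ hp
    linarith
  have g3 : w * m ≤ 1 := by linarith [abs_nonneg (Q - k w * m)]
  have hw2 : 0 < 1 + w ^ 2 := by positivity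
  have g4 : (1 - w * m) * (1 + w ^ 2) ≤ 1 := by
    rw [div_le_iff₀ hw2] at g2
    nlinarith
  have g5 : m ≤ 6 := by
    rcases le_or_gt w 1 with h1 | h1
    · have : (1 : ℝ) / 2 ≤ ph w := by
        unfold ph
        have := Real.add_one_le_exp (-(1 / 2) * w ^ 2)
        nlinarith
      have : (ph w)⁻¹ ≤ 2 := by
        rw [inv_le_comm₀ hp (by norm_num)]; linarith
      rw [hm]
      have := inv_pos.2 hp
      nlinarith
    · nlinarith
  have hkw := hk0 w
  rw [abs_of_nonneg hw] at hkw
  have a0 := abs_nonneg (k w)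
  have g6 : 0 ≤ 1 - w * m := by linarith
  have g7 : 1 - w * m ≤ 1 := by nlinarith
  have r1 : |Q| ≤ 8 := by
    have : Q = (Q - k w * m) + k w * m := by ring
    rw [this]
    refine (abs_add_le _ _).trans ?_
    rw [abs_mul (k w), abs_of_nonneg m0]
    nlinarith
  have r2 : |k w - w * Q| ≤ (2 * w + 1) * (1 - w * m) := by
    have : k w - w * Q = k w * (1 - w * m) - w * (Q - k w * m) := by ring
    rw [this]
    refine (abs_sub _ _).trans ?_
    rw [abs_mul, abs_mul, abs_of_nonneg hw, abs_of_nonneg g6]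
    nlinarith
  refine ⟨r1, ?_, ?_⟩
  · rw [abs_mul, abs_of_nonneg hw]
    have : w * ((2 * w + 1) * (1 - w * m)) ≤ 3 * ((1 - w * m) * (1 + w ^ 2)) := by
      have : w * (2 * w + 1) ≤ 3 * (1 + w ^ 2) := by nlinarith [sq_nonneg (w - 1)]
      nlinarith
    nlinarith
  · refine r2.trans ?_
    have : (2 * w + 1) ≤ 3 * (1 + w ^ 2) := by nlinarith [sq_nonneg (w - 1)]
    nlinarith

theorem stein_sol {k : ℝ → ℝ} (hk : ∀ s t, |k s - k t| ≤ |s - t|) (hk0 : ∀ w, |k w| ≤ |w| + 1)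
    (hz : ∫ t, k t * ph t = 0) :
    ∃ F F' : ℝ → ℝ, (∀ w, HasDerivAt F (F' w) w) ∧ (∀ w, |F' w| ≤ 12) ∧
      (∀ u v, |F' u - F' v| ≤ 12 * |u - v|) ∧ ∀ w, F' w - w * F w = k w := by
  have hc : Continuous k := by
    have : LipschitzWith 1 k := LipschitzWith.of_dist_le_mul fun s t => by
      simpa [Real.dist_eq] using hk s t
    exact this.continuous
  have kint := kph_int hk
  have kc : Continuous fun t => k t * ph t := hc.mul ph_cont
  let P : ℝ → ℝ := fun w => ∫ t in Set.Iic w, k t * ph t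
  have hP : ∀ w, HasDerivAt P (k w * ph w) w := by
    intro w
    have e : P = fun w => P 0 + ∫ t in (0 : ℝ)..w, k t * ph t := by
      funext v
      rw [← intervalIntegral.integral_Iic_sub_Iic kint.integrableOn kint.integrableOn]
      simp [P]
    rw [e]
    exact ((kc.integral_hasStrictDerivAt 0 w).hasDerivAt).const_add _
  let F : ℝ → ℝ := fun w => (ph w)⁻¹ * P w
  let F' : ℝ → ℝ := fun w => k w + w * F w
  have hF : ∀ w, HasDerivAt F (F' w) w := by
    intro w
    have hp := (ph_pos w).ne'
    refine (((ph_deriv w).inv hp).mul (hP w)).congr_deriv ?_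
    simp only [F', F, Pi.inv_apply]
    field_simp
    ring
  have bounds : ∀ w, |F w| ≤ 8 ∧ |w * F' w| ≤ 3 ∧ |F' w| ≤ 10 := by
    intro w
    rcases le_total 0 w with hw | hw
    · have e : P w = - ∫ t in Set.Ioi w, k t * ph t := by
        have := intervalIntegral.integral_Iic_add_Ioi (b := w) (f := fun t => k t * ph t)
          (μ := volume) kint.integrableOn kint.integrableOn
        rw [hz] at this
        simp only [P]; linarith
      obtain ⟨a, b, d⟩ := half hk hk0 w hw
      have eF : F w = - ((ph w)⁻¹ * ∫ t in Set.Ioi w, k t * ph t) := by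
        simp only [F, e]; ring
      have eF' : F' w = k w - w * ((ph w)⁻¹ * ∫ t in Set.Ioi w, k t * ph t) := by
        simp only [F', eF]; ring
      rw [eF', eF, abs_neg]
      exact ⟨a, b, d⟩
    · have hk' : ∀ s t, |k (-s) - k (-t)| ≤ |s - t| := by
        intro s t
        refine (hk _ _).trans (le_of_eq ?_)
        rw [← abs_neg]; congr 1; ring
      have hk0' : ∀ w, |k (-w)| ≤ |w| + 1 := by
        intro w; simpa using hk0 (-w)
      obtain ⟨a, b, d⟩ := half (k := fun t => k (-t)) hk' hk0' (-w) (by linarith)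
      have phn : ∀ t, ph (-t) = ph t := by intro t; simp [ph]
      have e : P w = ∫ t in Set.Ioi (-w), k (-t) * ph t := by
        have := integral_comp_neg_Iic w (fun t => k (-t) * ph t)
        rw [← this]
        simp [P, phn]
      simp only [neg_neg, phn] at a b d
      rw [← e] at a b d
      have eF' : F' w = k w - -w * ((ph w)⁻¹ * P w) := by
        simp only [F', F]; ring
      rw [eF']
      refine ⟨a, ?_, d⟩
      rw [neg_mul, abs_neg] at b
      exact b
  refine ⟨F, F', hF, fun w => (bounds w).2.2.trans (by norm_num), ?_, ?_⟩
  · intro u v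
    have hd : ∀ t, HasDerivAt (fun t => t * F t) (F t + t * F' t) t := fun t =>
      ((hasDerivAt_id t).mul (hF t)).congr_deriv (by simp)
    have hb : ∀ t ∈ Set.univ, ‖F t + t * F' t‖ ≤ 11 := by
      intro t _
      rw [Real.norm_eq_abs]
      have := bounds t
      exact (abs_add_le _ _).trans (by linarith [this.1, this.2.1])
    have := convex_univ.norm_image_sub_le_of_norm_hasDerivWithin_le
      (fun t _ => (hd t).hasDerivWithinAt) hb (Set.mem_univ v) (Set.mem_univ u)
    simp only [Real.norm_eq_abs] at this
    have e : F' u - F' v = (k u - k v) + (u * F u - v * F v) := by simp only [F']; ring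
    rw [e]
    refine (abs_add_le _ _).trans ?_
    linarith [hk u v]
  · intro w; simp only [F']; ring

theorem gauss_abs : ∫ z, |z| ∂(gaussianReal 0 1) ≤ 1 := by
  have hm : MemLp id 2 (gaussianReal 0 1) := memLp_id_gaussianReal 2
  have i2 : Integrable (fun z : ℝ => z ^ 2) (gaussianReal 0 1) := hm.integrable_sq
  have v : ∫ z, z ^ 2 ∂(gaussianReal 0 1) = 1 := by
    have := variance_id_gaussianReal (μ := 0) (v := 1)
    rw [variance_eq_sub hm] at this
    simpa using this
  have : ∫ z, |z| ∂(gaussianReal 0 1) ≤ ∫ z, (1 / 2 + 1 / 2 * z ^ 2) ∂(gaussianReal 0 1) := by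
    refine integral_mono (hm.integrable (by norm_num)).abs
      ((integrable_const _).add (i2.const_mul _)) fun z => ?_
    have := sq_nonneg (|z| - 1)
    show |z| ≤ 1 / 2 + 1 / 2 * z ^ 2
    rw [← sq_abs z]; nlinarith
  refine this.trans ?_
  rw [integral_add (integrable_const _) (i2.const_mul _), integral_const_mul, v]
  simp
  norm_num

theorem lip_int {f : ℝ → ℝ} (hf : LipschitzWith 1 f) : Integrable f (gaussianReal 0 1) := by
  have hm : Integrable (fun z : ℝ => z) (gaussianReal 0 1) :=
    (memLp_id_gaussianReal (μ := 0) (v := 1) 1).integrable (by norm_num)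
  refine (hm.abs.add (integrable_const |f 0|)).mono' hf.continuous.aestronglyMeasurable
    (Eventually.of_forall fun t => ?_)
  have h1 := hf.dist_le_mul t 0
  simp only [Real.dist_eq, NNReal.coe_one, one_mul, sub_zero] at h1
  have h2 := abs_sub_abs_le_abs_sub (f t) (f 0)
  simp only [Pi.add_apply, Real.norm_eq_abs]
  linarith

theorem lip_sub {f : ℝ → ℝ} (hf : LipschitzWith 1 f) (w : ℝ) :
    |f w - ∫ z, f z ∂(gaussianReal 0 1)| ≤ |w| + 1 := by
  have hm : Integrable (fun z : ℝ => z) (gaussianReal 0 1) :=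
    (memLp_id_gaussianReal (μ := 0) (v := 1) 1).integrable (by norm_num)
  have e : f w - ∫ z, f z ∂(gaussianReal 0 1) = ∫ z, (f w - f z) ∂(gaussianReal 0 1) := by
    rw [integral_sub (integrable_const _) (lip_int hf)]; simp
  rw [e, ← Real.norm_eq_abs]
  refine (norm_integral_le_of_norm_le ((integrable_const |w|).add hm.abs)
    (Eventually.of_forall fun z => ?_)).trans ?_
  · have h1 := hf.dist_le_mul w z
    simp only [Real.dist_eq, NNReal.coe_one, one_mul] at h1
    simp only [Pi.add_apply, Real.norm_eq_abs]
    exact h1.trans (abs_sub _ _)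
  · simp only [Pi.add_apply]
    rw [integral_add (integrable_const _) hm.abs]
    have := gauss_abs
    simpa using this

theorem stein_full {f : ℝ → ℝ} (hf : LipschitzWith 1 f) :
    ∃ F F' : ℝ → ℝ, (∀ w, HasDerivAt F (F' w) w) ∧ (∀ w, |F' w| ≤ 12) ∧
      (∀ u v, |F' u - F' v| ≤ 12 * |u - v|) ∧
      ∀ w, F' w - w * F w = f w - ∫ z, f z ∂(gaussianReal 0 1) := by
  refine stein_sol (k := fun w => f w - ∫ z, f z ∂(gaussianReal 0 1)) ?_ (lip_sub hf) ?_
  · intro s t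
    have h1 := hf.dist_le_mul s t
    simp only [Real.dist_eq, NNReal.coe_one, one_mul] at h1
    simpa using h1
  · have e : ∫ z, (f z - ∫ z, f z ∂(gaussianReal 0 1)) ∂(gaussianReal 0 1) = 0 := by
      rw [integral_sub (lip_int hf) (integrable_const _)]; simp
    rw [integral_gaussianReal_eq_integral_smul (by norm_num)] at e
    have e2 : ∀ t, gaussianPDFReal 0 1 t • (f t - ∫ z, f z ∂(gaussianReal 0 1)) =
        (Real.sqrt (2 * Real.pi))⁻¹ * ((f t - ∫ z, f z ∂(gaussianReal 0 1)) * ph t) := by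
      intro t
      simp only [gaussianPDFReal, ph, smul_eq_mul, NNReal.coe_one, mul_one, sub_zero]
      rw [show -t ^ 2 / 2 = -(1 / 2) * t ^ 2 by ring]; ring
    simp only [e2] at e
    rw [integral_const_mul] at e
    have : (Real.sqrt (2 * Real.pi))⁻¹ ≠ 0 := by positivity
    exact (mul_eq_zero.1 e).resolve_left this
end
end GSW

open MeasureTheory ProbabilityTheory
open scoped ENNReal NNReal
set_option linter.unusedSectionVars false
set_option linter.unusedVariables false
namespace GSW
noncomputable section

def IsCopy {ℓ n : ℕ} (G : SimpleGraph (Fin ℓ)) (S : Finset (Sym2 (Fin n))) : Prop :=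
  ∃ f : Fin ℓ ↪ Fin n, (↑S : Set (Sym2 (Fin n))) = Sym2.map f '' G.edgeSet

theorem isCopy_iff {ℓ n : ℕ} (G : SimpleGraph (Fin ℓ)) (S : Finset (Sym2 (Fin n))) :
    IsCopy G S ↔ ∃ f : Fin ℓ ↪ Fin n, (↑S : Set (Sym2 (Fin n))) = (G.map f).edgeSet := by
  unfold IsCopy
  simp only [SimpleGraph.edgeSet_map]
  rfl

theorem copy_iso {ℓ n : ℕ} {G₁ G₂ : SimpleGraph (Fin ℓ)} {S : Finset (Sym2 (Fin n))}
    (h1 : IsCopy G₁ S) (h2 : IsCopy G₂ S) : Nonempty (G₁ ≃g G₂) := by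
  obtain ⟨f1, h1⟩ := (isCopy_iff _ _).1 h1
  obtain ⟨f2, h2⟩ := (isCopy_iff _ _).1 h2
  have hX : G₁.map f1 = G₂.map f2 := SimpleGraph.edgeSet_inj.1 (h1.symm.trans h2)
  have hs : f1 '' G₁.support = f2 '' G₂.support := by
    rw [← SimpleGraph.support_map, ← SimpleGraph.support_map, hX]
  have : ∀ v : G₁.support, ∃ u, f2 u = f1 v := by
    intro v
    have : f1 v ∈ f2 '' G₂.support := hs ▸ Set.mem_image_of_mem f1 v.2
    obtain ⟨u, _, hu⟩ := this
    exact ⟨u, hu⟩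
  choose g hg using this
  obtain ⟨π, hπ⟩ := Equiv.Perm.exists_extending_pair (fun v : G₁.support => (v : Fin ℓ)) g
    Subtype.val_injective (by
      intro a b hab
      apply Subtype.ext
      apply f1.injective
      rw [← hg a, ← hg b, hab])
  have key : ∀ u ∈ G₁.support, f2 (π u) = f1 u := by
    intro u hu
    have := hπ ⟨u, hu⟩
    simp only at this
    rw [this, hg]
  refine ⟨⟨π, ?_⟩⟩
  intro u v
  constructor
  · intro h
    have h' : (G₁.map f1).Adj (f2 (π u)) (f2 (π v)) := by
      rw [hX]; exact SimpleGraph.map_adj_apply.2 h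
    obtain ⟨u', v', ha, hu, hv⟩ := (SimpleGraph.map_adj _ _ _ _).1 h'
    rw [← key u' ⟨v', ha⟩] at hu
    rw [← key v' ⟨u', ha.symm⟩] at hv
    have := π.injective (f2.injective hu)
    have := π.injective (f2.injective hv)
    subst_vars
    exact ha
  · intro h
    have h' : (G₂.map f2).Adj (f1 u) (f1 v) := by
      rw [← hX]; exact SimpleGraph.map_adj_apply.2 h
    rw [← key u ⟨v, h⟩, ← key v ⟨u, h.symm⟩] at h'
    exact SimpleGraph.map_adj_apply.1 h'

def Str {n : ℕ} (S : Finset (Sym2 (Fin n))) (t : Finset (Fin n)) : Prop :=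
  t.card = 3 ∧ S ⊆ t.sym2 ∧ (∀ e ∈ S, ¬ e.IsDiag) ∧ ∀ v ∈ t, ∃ e ∈ S, v ∈ e

theorem str_of_graph {n : ℕ} (X : SimpleGraph (Fin n)) (S : Finset (Sym2 (Fin n)))
    (hS : (↑S : Set (Sym2 (Fin n))) = X.edgeSet) (t : Finset (Fin n)) (ht : (t : Set (Fin n)) = X.support)
    (h3 : t.card = 3) : Str S t := by
  have mS : ∀ e, e ∈ S ↔ e ∈ X.edgeSet := fun e => by rw [← hS, Finset.mem_coe]
  have mt : ∀ v, v ∈ t ↔ v ∈ X.support := fun v => by rw [← ht, Finset.mem_coe]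
  refine ⟨h3, ?_, ?_, ?_⟩
  · intro e he
    rw [mS] at he
    induction e with
    | _ a b =>
      rw [SimpleGraph.mem_edgeSet] at he
      rw [Finset.mk_mem_sym2_iff, mt, mt]
      exact ⟨⟨b, he⟩, ⟨a, he.symm⟩⟩
  · intro e he
    exact X.not_isDiag_of_mem_edgeSet ((mS e).1 he)
  · intro v hv
    obtain ⟨w, hw⟩ := (mt v).1 hv
    exact ⟨s(v, w), (mS _).2 hw, by simp⟩

theorem copy_str {ℓ n : ℕ} {G : SimpleGraph (Fin ℓ)} {S : Finset (Sym2 (Fin n))}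
    (h : IsCopy G S) (h3 : Nat.card G.support = 3) : ∃ t, Str S t := by
  classical
  obtain ⟨f, hf⟩ := (isCopy_iff _ _).1 h
  refine ⟨(G.map f).support.toFinset, str_of_graph (G.map f) S hf _ (by simp) ?_⟩
  rw [← h3, ← Set.ncard_eq_toFinset_card', SimpleGraph.support_map,
    Set.ncard_image_of_injective _ f.injective]
  rfl

theorem exists_copy {ℓ n : ℕ} (hn : ℓ ≤ n) {G : SimpleGraph (Fin ℓ)} (h3 : Nat.card G.support = 3)
    (t : Finset (Fin n)) (ht : t.card = 3) : ∃ S : Finset (Sym2 (Fin n)), IsCopy G S ∧ Str S t := by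
  classical
  let e0 : Fin ℓ ↪ Fin n := Fin.castLEEmb hn
  have hc : ((G.map e0).support.toFinset).card = t.card := by
    rw [ht, ← h3, ← Set.ncard_eq_toFinset_card', SimpleGraph.support_map,
      Set.ncard_image_of_injective _ e0.injective]
    rfl
  obtain ⟨π, hπ⟩ := Equiv.Perm.exists_map_finset_eq _ _ hc
  let f : Fin ℓ ↪ Fin n := e0.trans π.toEmbedding
  refine ⟨(G.map f).edgeSet.toFinset, (isCopy_iff _ _).2 ⟨f, by simp⟩,
    str_of_graph (G.map f) _ (by simp) t ?_ ht⟩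
  rw [← hπ, Finset.coe_map, Set.coe_toFinset, SimpleGraph.support_map, SimpleGraph.support_map,
    ← Set.image_comp]
  rfl

theorem Str.inj {n : ℕ} {S : Finset (Sym2 (Fin n))} {t t' : Finset (Fin n)}
    (h : Str S t) (h' : Str S t') : t = t' := by
  have key : ∀ t t' : Finset (Fin n), Str S t → Str S t' → t ⊆ t' := by
    intro t t' h h' v hv
    obtain ⟨e, he, hve⟩ := h.2.2.2 v hv
    exact Finset.mem_sym2_iff.1 (h'.2.1 he) v hve
  exact (key _ _ h h').antisymm (key _ _ h' h)

theorem toFinset_sub {n : ℕ} {e : Sym2 (Fin n)} {t : Finset (Fin n)} (h : e ∈ t.sym2) :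
    e.toFinset ⊆ t := by
  intro v hv
  exact Finset.mem_sym2_iff.1 h v (Sym2.mem_toFinset.1 hv)

theorem Str.card_le {n : ℕ} {S : Finset (Sym2 (Fin n))} {t : Finset (Fin n)}
    (h : Str S t) : S.card ≤ 6 := by
  refine (Finset.card_le_card h.2.1).trans ?_
  rw [Finset.card_sym2, h.1]; decide

theorem Str.two {n : ℕ} {S : Finset (Sym2 (Fin n))} {t : Finset (Fin n)}
    (h : Str S t) : 2 ≤ S.card := by
  by_contra hlt
  have h1 : S.card ≤ 1 := by omega
  have hne : t.Nonempty := Finset.card_pos.1 (by rw [h.1]; norm_num)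
  obtain ⟨v, hv⟩ := hne
  obtain ⟨e, he, _⟩ := h.2.2.2 v hv
  have : t ⊆ e.toFinset := by
    intro u hu
    obtain ⟨e', he', hu'⟩ := h.2.2.2 u hu
    rw [Finset.card_le_one.1 h1 e he e' he']
    exact Sym2.mem_toFinset.2 hu'
  have := Finset.card_le_card this
  rw [h.1, Sym2.card_toFinset_of_not_isDiag e (h.2.2.1 e he)] at this
  omega

theorem Str.eq_union {n : ℕ} {S : Finset (Sym2 (Fin n))} {t : Finset (Fin n)}
    (h : Str S t) {i g : Sym2 (Fin n)} (hi : i ∈ S) (hg : g ∈ S) (hig : i ≠ g) :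
    i.toFinset ∪ g.toFinset = t := by
  have c1 := Sym2.card_toFinset_of_not_isDiag i (h.2.2.1 i hi)
  have c2 := Sym2.card_toFinset_of_not_isDiag g (h.2.2.1 g hg)
  refine Finset.eq_of_subset_of_card_le
    (Finset.union_subset (toFinset_sub (h.2.1 hi)) (toFinset_sub (h.2.1 hg))) ?_
  rw [h.1]
  by_contra hlt
  have e1 : i.toFinset = i.toFinset ∪ g.toFinset :=
    Finset.eq_of_subset_of_card_le Finset.subset_union_left (by omega)
  have e2 : g.toFinset = i.toFinset ∪ g.toFinset :=
    Finset.eq_of_subset_of_card_le Finset.subset_union_right (by omega)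
  apply hig
  apply Sym2.ext
  intro v
  rw [← Sym2.mem_toFinset, ← Sym2.mem_toFinset, e1.trans e2.symm]

open Classical in
def Nb {n : ℕ} (i : Sym2 (Fin n)) : Finset (Sym2 (Fin n)) :=
  Finset.univ.filter fun g => ∃ t : Finset (Fin n), t.card = 3 ∧ i ∈ t.sym2 ∧ g ∈ t.sym2 ∧
    ¬ i.IsDiag ∧ ¬ g.IsDiag

theorem Nb_card {n : ℕ} (i : Sym2 (Fin n)) : (Nb i).card ≤ n * 6 := by
  classical
  have hsub : Nb i ⊆ (Finset.univ : Finset (Fin n)).biUnion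
      fun w => (insert w i.toFinset).sym2 := by
    intro g hg
    simp only [Nb, Finset.mem_filter, Finset.mem_univ, true_and] at hg
    obtain ⟨t, h3, hi, hg, di, dg⟩ := hg
    have c1 := Sym2.card_toFinset_of_not_isDiag i di
    obtain ⟨w, hw⟩ : ∃ w, t \ i.toFinset = {w} := by
      rw [← Finset.card_eq_one, Finset.card_sdiff_of_subset (toFinset_sub hi)]; omega
    simp only [Finset.mem_biUnion, Finset.mem_univ, true_and]
    refine ⟨w, ?_⟩
    have : insert w i.toFinset = t := by
      rw [← Finset.sdiff_union_of_subset (toFinset_sub hi), hw]; rfl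
    rw [this]; exact hg
  refine (Finset.card_le_card hsub).trans ?_
  refine (Finset.card_biUnion_le_card_mul _ _ 6 fun w _ => ?_).trans (by simp)
  rw [Finset.card_sym2]
  have : (insert w i.toFinset).card ≤ 3 := by
    refine (Finset.card_insert_le _ _).trans ?_
    rw [Sym2.card_toFinset]; split_ifs <;> norm_num
  calc ((insert w i.toFinset).card + 1).choose 2 ≤ (3 + 1).choose 2 := Nat.choose_le_choose 2 (by omega)
    _ = 6 := by decide

theorem co_card {n : ℕ} (i g : Sym2 (Fin n)) (hig : i ≠ g) (T : Finset (Finset (Sym2 (Fin n))))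
    (hT : ∀ S ∈ T, i ∈ S ∧ g ∈ S ∧ ∃ t, Str S t) : T.card ≤ 1024 := by
  have hsub : T ⊆ ((i.toFinset ∪ g.toFinset).sym2).powerset := by
    intro S hS
    obtain ⟨hi, hg, t, ht⟩ := hT S hS
    rw [Finset.mem_powerset, ht.eq_union hi hg hig]
    exact ht.2.1
  refine (Finset.card_le_card hsub).trans ?_
  rw [Finset.card_powerset, Finset.card_sym2]
  have : (i.toFinset ∪ g.toFinset).card ≤ 4 := by
    refine (Finset.card_union_le _ _).trans ?_
    rw [Sym2.card_toFinset, Sym2.card_toFinset]; split_ifs <;> norm_num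
  calc 2 ^ ((i.toFinset ∪ g.toFinset).card + 1).choose 2 ≤ 2 ^ ((4 + 1).choose 2) :=
        Nat.pow_le_pow_right (by norm_num) (Nat.choose_le_choose 2 (by omega))
    _ = 1024 := by decide

open Classical in
def cof {ℓ : ℕ} (n : ℕ) (ℋ : Finset (SimpleGraph (Fin ℓ))) (Δ : SimpleGraph (Fin ℓ) → ℝ)
    (S : Finset (Sym2 (Fin n))) : ℝ :=
  ∑ G ∈ ℋ.filter fun G => Nat.card G.support = 3, if IsCopy G S then Δ G else 0

theorem cof_str {ℓ n : ℕ} {ℋ : Finset (SimpleGraph (Fin ℓ))} {Δ : SimpleGraph (Fin ℓ) → ℝ}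
    {S : Finset (Sym2 (Fin n))} (h : cof n ℋ Δ S ≠ 0) : ∃ t, Str S t := by
  obtain ⟨G, hG, hne⟩ := Finset.exists_ne_zero_of_sum_ne_zero h
  split_ifs at hne with hc
  · exact copy_str hc (Finset.mem_filter.1 hG).2
  · exact absurd rfl hne

theorem cof_abs {ℓ n : ℕ} {ℋ : Finset (SimpleGraph (Fin ℓ))} {Δ : SimpleGraph (Fin ℓ) → ℝ}
    {lam : ℝ} (hl : 0 < lam) (hΔ : ∀ G ∈ ℋ, |Δ G| ≤ 1 / lam)
    (S : Finset (Sym2 (Fin n))) :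
    |cof n ℋ Δ S| ≤ (Nat.card (SimpleGraph (Fin ℓ)) : ℝ) * (1 / lam) := by
  classical
  unfold cof
  refine (Finset.abs_sum_le_sum_abs _ _).trans ?_
  refine (Finset.sum_le_card_nsmul _ _ (1 / lam) ?_).trans ?_
  · intro G hG
    split_ifs
    · exact hΔ G (Finset.mem_filter.1 hG).1
    · simp; positivity
  · rw [nsmul_eq_mul]
    refine mul_le_mul_of_nonneg_right ?_ (by positivity)
    rw [Nat.card_eq_fintype_card]
    exact_mod_cast Finset.card_le_univ _

theorem cof_copy {ℓ n : ℕ} {ℋ : Finset (SimpleGraph (Fin ℓ))} {Δ : SimpleGraph (Fin ℓ) → ℝ}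
    (hiso : ∀ G₁ ∈ ℋ, ∀ G₂ ∈ ℋ, Nonempty (G₁ ≃g G₂) → G₁ = G₂)
    {G : SimpleGraph (Fin ℓ)} (hG : G ∈ ℋ) (h3 : Nat.card G.support = 3)
    {S : Finset (Sym2 (Fin n))} (hS : IsCopy G S) : cof n ℋ Δ S = Δ G := by
  unfold cof
  rw [Finset.sum_eq_single G]
  · simp [hS]
  · intro G' hG' hne
    rw [if_neg]
    intro hc
    exact hne (hiso G' (Finset.mem_filter.1 hG').1 G hG (copy_iso hc hS))
  · intro h
    exact absurd (Finset.mem_filter.2 ⟨hG, h3⟩) h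

theorem cof_lower {ℓ n : ℕ} (hn : ℓ ≤ n) (hℓ : 3 ≤ ℓ) {ℋ ℋ' : Finset (SimpleGraph (Fin ℓ))}
    {Δ : SimpleGraph (Fin ℓ) → ℝ} {lam : ℝ} (hl : 0 < lam) (h : IsFactorSystem ℓ lam ℋ ℋ' Δ) :
    (lam / 13) ^ 2 * (n : ℝ) ^ 3 ≤ ∑ S : Finset (Sym2 (Fin n)), cof n ℋ Δ S ^ 2 := by
  classical
  obtain ⟨hsub, hiso, hconn, hup, hlow⟩ := h
  obtain ⟨G, hG', -, h3⟩ := hconn 3 le_rfl hℓ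
  have hG := hsub hG'
  have hd := hlow G hG'
  have ex : ∀ t : Finset (Fin n), ∃ S : Finset (Sym2 (Fin n)), t.card = 3 → IsCopy G S ∧ Str S t := by
    intro t
    by_cases ht : t.card = 3
    · obtain ⟨S, hS⟩ := exists_copy hn h3 t ht
      exact ⟨S, fun _ => hS⟩
    · exact ⟨∅, fun h => absurd h ht⟩
  choose Sf hSf using ex
  let U := (Finset.univ : Finset (Fin n)).powersetCard 3
  have mU : ∀ t ∈ U, t.card = 3 := fun t ht => (Finset.mem_powersetCard.1 ht).2
  have hinj : Set.InjOn Sf U := by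
    intro t ht t' ht' heq
    have a := (hSf t (mU t ht)).2
    have b := (hSf t' (mU t' ht')).2
    rw [← heq] at b
    exact a.inj b
  have h1 : ∑ S ∈ U.image Sf, cof n ℋ Δ S ^ 2 ≤ ∑ S : Finset (Sym2 (Fin n)), cof n ℋ Δ S ^ 2 :=
    Finset.sum_le_sum_of_subset_of_nonneg (Finset.subset_univ _) fun _ _ _ => sq_nonneg _
  refine le_trans ?_ h1
  rw [Finset.sum_image hinj]
  have h2 : ∀ t ∈ U, lam ^ 2 ≤ cof n ℋ Δ (Sf t) ^ 2 := by
    intro t ht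
    rw [cof_copy hiso hG h3 (hSf t (mU t ht)).1, ← sq_abs (Δ G)]
    gcongr
  refine le_trans ?_ (Finset.card_nsmul_le_sum _ _ _ h2)
  rw [nsmul_eq_mul, Finset.card_powersetCard, Finset.card_univ, Fintype.card_fin]
  have h4 := Nat.pow_le_choose (α := ℝ) 3 n
  have h5 : ((n + 1 - 3 : ℕ) : ℝ) = (n : ℝ) - 2 := by
    rw [Nat.cast_sub (by omega)]; push_cast; ring
  rw [h5, show (Nat.factorial 3) = 6 by decide] at h4
  have hn3 : (3 : ℝ) ≤ n := by exact_mod_cast hℓ.trans hn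
  have h6 : ((n : ℝ) / 3) ^ 3 ≤ ((n : ℝ) - 2) ^ 3 := by
    gcongr
    linarith
  have h7 : (n : ℝ) ^ 3 / 169 ≤ (n.choose 3 : ℝ) := by
    refine le_trans ?_ h4
    have : 0 ≤ (n : ℝ) ^ 3 := by positivity
    push_cast
    rw [div_pow] at h6
    linarith
  calc (lam / 13) ^ 2 * (n : ℝ) ^ 3 = (n : ℝ) ^ 3 / 169 * lam ^ 2 := by ring
    _ ≤ _ := by gcongr

theorem part_eq {ℓ n : ℕ} (ℋ : Finset (SimpleGraph (Fin ℓ))) (Δ : SimpleGraph (Fin ℓ) → ℝ) (p : ℝ)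
    (x : Sym2 (Fin n) → Bool) :
    graphStatPart ℓ ℋ Δ p 3 x = (n : ℝ) ^ (ℓ - 3) * Wp p (cof n ℋ Δ) x := by
  classical
  unfold graphStatPart Wp cof graphFactor
  simp_rw [Finset.sum_mul]
  rw [Finset.sum_comm, Finset.mul_sum]
  refine Finset.sum_congr rfl fun G hG => ?_
  rw [(Finset.mem_filter.1 hG).2, mul_assoc]
  congr 1
  rw [Finset.mul_sum]
  refine Finset.sum_congr rfl fun S _ => ?_
  by_cases h : IsCopy G S
  · have h' : ∃ f : Fin ℓ ↪ Fin n, (↑S : Set (Sym2 (Fin n))) = Sym2.map f '' G.edgeSet := h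
    rw [if_pos h, if_pos h']; rfl
  · have h' : ¬ ∃ f : Fin ℓ ↪ Fin n, (↑S : Set (Sym2 (Fin n))) = Sym2.map f '' G.edgeSet := h
    rw [if_neg h, if_neg h']; simp

theorem int_gnp {n : ℕ} {p : ℝ} (h0 : 0 ≤ p) (h1 : p ≤ 1) (F : (Sym2 (Fin n) → Bool) → ℝ) :
    ∫ x, F x ∂(gnp n p) = Ex p F := by
  unfold gnp bernoulliPi
  rw [integral_finsetSum_measure]
  · unfold Ex
    refine Finset.sum_congr rfl fun x _ => ?_
    rw [integral_smul_measure, integral_dirac, ENNReal.toReal_prod, smul_eq_mul]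
    congr 1
    refine Finset.prod_congr rfl fun i _ => ?_
    exact ENNReal.toReal_ofReal (wt_nonneg h0 h1 _)
  · intro x _
    refine Integrable.smul_measure (integrable_dirac (by simp)) ?_
    exact ENNReal.prod_ne_top fun i _ => ENNReal.ofReal_ne_top

theorem chi_abs {lam p : ℝ} (hl : 0 < lam) (hl2 : lam < 1 / 2) (hp : p ∈ Set.Ioo lam (1 - lam)) (b : Bool) :
    |chi p b| ≤ 1 / lam := by
  obtain ⟨h1, h2⟩ := hp
  have hpp : lam ^ 2 ≤ p * (1 - p) := by nlinarith
  have hs : lam ≤ Real.sqrt (p * (1 - p)) := Real.le_sqrt_of_sq_le hpp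
  unfold chi
  rw [abs_div, abs_of_nonneg (Real.sqrt_nonneg _)]
  have : |(if b then (1 : ℝ) else 0) - p| ≤ 1 := by
    rw [abs_le]
    split_ifs <;> constructor <;> linarith
  gcongr

theorem mon_abs {ι : Type*} [Fintype ι] [DecidableEq ι] {p M : ℝ} (hM : 1 ≤ M)
    (hchi : ∀ b, |chi p b| ≤ M) (S : Finset ι) (hS : S.card ≤ 6) (x : ι → Bool) : |mon p S x| ≤ M ^ 6 := by
  unfold mon
  rw [Finset.abs_prod]
  refine (Finset.prod_le_prod (fun _ _ => abs_nonneg _) (fun i _ => hchi _)).trans ?_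
  rw [Finset.prod_const]
  exact pow_le_pow_right₀ hM hS

theorem cof_good {ℓ n : ℕ} (hn : 1 ≤ n) {ℋ : Finset (SimpleGraph (Fin ℓ))} {Δ : SimpleGraph (Fin ℓ) → ℝ}
    {lam p M K : ℝ} (hl : 0 < lam) (hΔ : ∀ G ∈ ℋ, |Δ G| ≤ 1 / lam) (hM : 1 ≤ M)
    (hchi : ∀ b, |chi p b| ≤ M)
    (hK : K = 1024 + (Nat.card (SimpleGraph (Fin ℓ)) : ℝ) * (1 / lam) * M ^ 6) :
    Good p K n (cof n ℋ Δ) Nb := by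
  have hK0 : 0 ≤ (Nat.card (SimpleGraph (Fin ℓ)) : ℝ) * (1 / lam) * M ^ 6 := by positivity
  refine ⟨by linarith, by exact_mod_cast hn, ?_, ?_, ?_, ?_, ?_, ?_⟩
  · intro S i hi x
    by_cases hc : cof n ℋ Δ S = 0
    · rw [hc]; simp; linarith
    obtain ⟨t, ht⟩ := cof_str hc
    rw [abs_mul]
    have a := cof_abs hl hΔ S
    have b := mon_abs hM hchi (S.erase i)
      ((Finset.card_le_card (Finset.erase_subset _ _)).trans ht.card_le) x
    have := mul_le_mul a b (abs_nonneg _) (by positivity)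
    linarith
  · intro i g hig
    have := co_card i g hig (Finset.univ.filter fun S => i ∈ S ∧ g ∈ S ∧ cof n ℋ Δ S ≠ 0) (by
      intro S hS
      simp only [Finset.mem_filter, Finset.mem_univ, true_and] at hS
      exact ⟨hS.1, hS.2.1, cof_str hS.2.2⟩)
    have : ((Finset.univ.filter fun S => i ∈ S ∧ g ∈ S ∧ cof n ℋ Δ S ≠ 0).card : ℝ) ≤ 1024 := by
      exact_mod_cast this
    linarith
  · intro S hS i hi g hg hig
    obtain ⟨t, ht⟩ := cof_str hS
    simp only [Nb, Finset.mem_filter, Finset.mem_univ, true_and]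
    exact ⟨t, ht.1, ht.2.1 hi, ht.2.1 hg, ht.2.2.1 i hi, ht.2.2.1 g hg⟩
  · intro i g hg
    simp only [Nb, Finset.mem_filter, Finset.mem_univ, true_and] at hg ⊢
    obtain ⟨t, a, b, c, d, e⟩ := hg
    exact ⟨t, a, c, b, e, d⟩
  · intro i
    have : ((Nb i).card : ℝ) ≤ n * 6 := by exact_mod_cast Nb_card i
    have hn' : (1 : ℝ) ≤ n := by exact_mod_cast hn
    nlinarith
  · intro S hS
    obtain ⟨t, ht⟩ := cof_str hS
    exact ht.two

theorem card_le (n : ℕ) (hn : 1 ≤ n) : (Fintype.card (Sym2 (Fin n)) : ℝ) ≤ (n : ℝ) ^ 2 := by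
  rw [Sym2.card, Fintype.card_fin]
  have h : (n + 1).choose 2 ≤ n ^ 2 := by
    rw [Nat.choose_two_right]
    refine Nat.div_le_of_le_mul ?_
    simp only [Nat.add_sub_cancel]
    nlinarith
  exact_mod_cast h

theorem main_large {ℓ n : ℕ} (hℓ : 3 ≤ ℓ) (hn : ℓ ≤ n) {lam p : ℝ} (hl : 0 < lam) (hl2 : lam < 1 / 2)
    (hp : p ∈ Set.Ioo lam (1 - lam)) {ℋ ℋ' : Finset (SimpleGraph (Fin ℓ))}
    {Δ : SimpleGraph (Fin ℓ) → ℝ} (h : IsFactorSystem ℓ lam ℋ ℋ' Δ)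
    {f : ℝ → ℝ} (hf : LipschitzWith 1 f) {K M κ s : ℝ} (hM : M = 1 / lam) (hκ : κ = lam / 13)
    (hK : K = 1024 + (Nat.card (SimpleGraph (Fin ℓ)) : ℝ) * (1 / lam) * M ^ 6)
    (hs : 0 ≤ s) (hs2 : Ex p (fun x => Wp p (cof n ℋ Δ) x ^ 2) = s ^ 2) :
    0 < s ∧ |Ex p (fun x => f (Wp p (cof n ℋ Δ) x / s)) - ∫ z, f z ∂(gaussianReal 0 1)| ≤
      (144 * K ^ 6 / κ ^ 2 + 96 * M ^ 3 * K ^ 9 / κ ^ 3) / Real.sqrt n := by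
  have h0 : 0 < p := hl.trans hp.1
  have h1 : p < 1 := by linarith [hp.2]
  have hM1 : 1 ≤ M := by
    rw [hM, le_div_iff₀ hl]; linarith
  have hκ0 : 0 < κ := by rw [hκ]; positivity
  have hchi : ∀ b, |chi p b| ≤ M := by rw [hM]; exact chi_abs hl hl2 hp
  have hn1 : 1 ≤ n := by omega
  have good : Good p K n (cof n ℋ Δ) Nb := cof_good hn1 hl h.2.2.2.1 hM1 hchi hK
  have hK1 := good.hK
  have low := cof_lower hn hℓ hl h
  rw [← Ex_Wp_sq h0 h1, hs2, ← hκ] at low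
  set r := Real.sqrt n with hr
  have hr0 : 0 < r := Real.sqrt_pos.2 (by exact_mod_cast hn1)
  have hnr : (n : ℝ) = r ^ 2 := (Real.sq_sqrt (by positivity)).symm
  have hsr : κ * r ^ 3 ≤ s := by
    refine abs_le_of_sq_le_sq' ?_ hs |>.2
    refine le_trans (le_of_eq ?_) low
    rw [hnr]; ring
  have hs0 : 0 < s := lt_of_lt_of_le (by positivity) hsr
  refine ⟨hs0, ?_⟩
  obtain ⟨F, F', hF, hA, hL, hE⟩ := stein_full hf
  have hι : (Fintype.card (Sym2 (Fin n)) : ℝ) ≤ K * (n : ℝ) ^ 2 := by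
    refine (card_le n hn1).trans ?_
    nlinarith [sq_nonneg (n : ℝ)]
  have st := good.stein h0 h1 hM1 hchi hs0 hι hs2 hF hA hL
  simp only [hE] at st
  rw [Ex_sub, Ex_const] at st
  refine st.trans ?_
  have e5 : Real.sqrt ((n : ℝ) ^ 5) = r ^ 5 := by
    rw [hnr, ← pow_mul, show 2 * 5 = 5 * 2 by norm_num, pow_mul, Real.sqrt_sq (by positivity)]
  rw [e5, hnr]
  calc 12 * 12 * K ^ 6 * r ^ 5 / s ^ 2 + 8 * 12 * M ^ 3 * K ^ 9 * (r ^ 2) ^ 4 / s ^ 3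
      ≤ 12 * 12 * K ^ 6 * r ^ 5 / (κ * r ^ 3) ^ 2 +
        8 * 12 * M ^ 3 * K ^ 9 * (r ^ 2) ^ 4 / (κ * r ^ 3) ^ 3 := by gcongr
    _ = _ := by field_simp; ring

theorem part_small {ℓ n : ℕ} (hn : n < ℓ) (ℋ : Finset (SimpleGraph (Fin ℓ)))
    (Δ : SimpleGraph (Fin ℓ) → ℝ) (p : ℝ) (x : Sym2 (Fin n) → Bool) :
    graphStatPart ℓ ℋ Δ p 3 x = 0 := by
  rw [part_eq]
  have : ∀ S, cof n ℋ Δ S = 0 := by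
    intro S
    unfold cof
    refine Finset.sum_eq_zero fun G _ => ?_
    rw [if_neg]
    rintro ⟨f, _⟩
    have := Fintype.card_le_of_embedding f
    simp at this
    omega
  simp [Wp, this]

end
end GSW


theorem graph_stat_wasserstein
    (ℓ : ℕ) (hℓ : 3 ≤ ℓ) (lam : ℝ) (hlam : lam ∈ Set.Ioo (0 : ℝ) (1 / 2)) :
    ∃ C : ℝ, 0 < C ∧ ∀ n : ℕ, 3 ≤ n → ∀ p ∈ Set.Ioo lam (1 - lam),
      ∀ ℋ ℋ' : Finset (SimpleGraph (Fin ℓ)), ∀ Δ : SimpleGraph (Fin ℓ) → ℝ,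
        IsFactorSystem ℓ lam ℋ ℋ' Δ →
        let W3 : (Sym2 (Fin n) → Bool) → ℝ := graphStatPart ℓ ℋ Δ p 3
        let σ := Real.sqrt (∫ x, (W3 x - ∫ y, W3 y ∂(gnp n p)) ^ 2 ∂(gnp n p))
        ∀ f : ℝ → ℝ, LipschitzWith 1 f →
          |(∫ x, f (W3 x / σ) ∂(gnp n p)) -
              ∫ z, f z ∂(ProbabilityTheory.gaussianReal 0 1)| ≤ C / Real.sqrt n := by
  obtain ⟨hl, hl2⟩ := hlam
  obtain ⟨M, hM⟩ : ∃ M : ℝ, M = 1 / lam := ⟨_, rfl⟩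
  obtain ⟨κ, hκ⟩ : ∃ κ : ℝ, κ = lam / 13 := ⟨_, rfl⟩
  obtain ⟨K, hK⟩ : ∃ K : ℝ, K = 1024 + (Nat.card (SimpleGraph (Fin ℓ)) : ℝ) * (1 / lam) * M ^ 6 :=
    ⟨_, rfl⟩
  have hM0 : 0 < M := by rw [hM]; positivity
  have hκ0 : 0 < κ := by rw [hκ]; positivity
  have hK0 : 0 < K := by rw [hK]; positivity
  have hA0 : 0 < 144 * K ^ 6 / κ ^ 2 + 96 * M ^ 3 * K ^ 9 / κ ^ 3 := by positivity
  refine ⟨144 * K ^ 6 / κ ^ 2 + 96 * M ^ 3 * K ^ 9 / κ ^ 3 + ℓ, by positivity, ?_⟩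
  intro n hn p hp ℋ ℋ' Δ hsys W3 σ f hf
  have h0 : 0 < p := hl.trans hp.1
  have h1 : p < 1 := by linarith [hp.2]
  have hr0 : 0 < Real.sqrt n := Real.sqrt_pos.2 (by exact_mod_cast (by omega : 0 < n))
  rcases lt_or_ge n ℓ with hnl | hnl
  · have hW : ∀ x, W3 x = 0 := fun x => GSW.part_small hnl ℋ Δ p x
    have e : ∫ x, f (W3 x / σ) ∂(gnp n p) = f 0 := by
      rw [GSW.int_gnp h0.le h1.le]
      simp only [hW, zero_div]
      exact GSW.Ex_const p _
    rw [e]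
    have b := GSW.lip_sub hf 0
    rw [abs_zero, zero_add] at b
    refine b.trans ?_
    rw [le_div_iff₀ hr0, one_mul]
    have : Real.sqrt n ≤ ℓ := by
      have hl1 : (1 : ℝ) ≤ ℓ := by exact_mod_cast (by omega : 1 ≤ ℓ)
      have hnl' : (n : ℝ) ≤ ℓ := by exact_mod_cast hnl.le
      rw [Real.sqrt_le_left (by linarith)]
      nlinarith
    linarith
  · have hWe : ∀ x, W3 x = (n : ℝ) ^ (ℓ - 3) * GSW.Wp p (GSW.cof n ℋ Δ) x :=
      fun x => GSW.part_eq ℋ Δ p x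
    have hc2 : ∀ S, GSW.cof n ℋ Δ S ≠ 0 → 2 ≤ S.card := by
      intro S hS
      obtain ⟨t, ht⟩ := GSW.cof_str hS
      exact ht.two
    have hmean : ∫ y, W3 y ∂(gnp n p) = 0 := by
      rw [GSW.int_gnp h0.le h1.le]
      have : W3 = fun x => (n : ℝ) ^ (ℓ - 3) * GSW.Wp p (GSW.cof n ℋ Δ) x := funext hWe
      rw [this, GSW.Ex_mul, GSW.Ex_Wp p _ hc2, mul_zero]
    have hnn : 0 < (n : ℝ) ^ (ℓ - 3) := by
      have : 0 < (n : ℝ) := by exact_mod_cast (by omega : 0 < n)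
      positivity
    obtain ⟨s, hs⟩ : ∃ s, s = Real.sqrt (GSW.Ex p (fun x => GSW.Wp p (GSW.cof n ℋ Δ) x ^ 2)) :=
      ⟨_, rfl⟩
    have hE0 : 0 ≤ GSW.Ex p (fun x => GSW.Wp p (GSW.cof n ℋ Δ) x ^ 2) :=
      GSW.Ex_nonneg h0.le h1.le fun x => sq_nonneg _
    have hσ : σ = (n : ℝ) ^ (ℓ - 3) * s := by
      simp only [σ, hmean, sub_zero]
      rw [GSW.int_gnp h0.le h1.le]
      simp only [hWe, mul_pow]
      rw [GSW.Ex_mul, Real.sqrt_mul (by positivity), Real.sqrt_sq hnn.le, ← hs]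
    obtain ⟨hs0, hmain⟩ := GSW.main_large hℓ hnl hl hl2 hp hsys hf hM hκ hK
      (hs ▸ Real.sqrt_nonneg _ : 0 ≤ s) (by rw [hs, Real.sq_sqrt hE0])
    have e : ∫ x, f (W3 x / σ) ∂(gnp n p) =
        GSW.Ex p (fun x => f (GSW.Wp p (GSW.cof n ℋ Δ) x / s)) := by
      rw [GSW.int_gnp h0.le h1.le]
      congr 1; funext x
      rw [hWe, hσ, mul_div_mul_left _ _ hnn.ne']
    rw [e]
    refine hmain.trans ?_
    refine div_le_div_of_nonneg_right ?_ hr0.le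
    have : (0 : ℝ) ≤ ℓ := by positivity
    linarith
end
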